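/- Let A be a non-empty set of positive integers which is either finite or satisfies Σ_{j∈ℕ∖A} 1/j < ∞, let d = sup A, and let Γ be an A-graph. Then p_N^(A)(Γ) ∼ N^{−E(Γ) + L(Γ) + Σ_P (l(P)/d − 1)} as N → ∞ along those N with S_N^(A) ≠ ∅, where E(Γ) and L(Γ) are the numbers of edges and loops of Γ, the sum runs over all loops P of Γ, l(P) is the length of P, and l(P)/∞ := 0 when d = ∞. -/

import Mathlib

noncomputable section

open Filter Topology

/-- A finite, directed, edge-colored graph with colors in `Fin s`,
with vertices living in an ambient type `V`. -/
structure CGraph (V : Type) (s : ℕ) where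
  verts : Set V
  finite : verts.Finite
  nonem : verts.Nonempty
  E : Fin s → V → V → Prop
  memL : ∀ r a b, E r a b → a ∈ verts
  memR : ∀ r a b, E r a b → b ∈ verts

namespace CGraph

variable {V W : Type} {s : ℕ}

/-- A graph is trivial iff it has no edges (of any color). -/
def Trivial (Γ : CGraph V s) : Prop := ∀ r a b, ¬ Γ.E r a b

/-- Two vertices are adjacent iff there is an edge (of any color, either direction)
between them. -/
def Adj (Γ : CGraph V s) (a b : V) : Prop := ∃ r, Γ.E r a b ∨ Γ.E r b a

/-- A graph is connected iff any two of its vertices are joined by a finite chain of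
edges (of any colors and either direction). -/
def Connected (Γ : CGraph V s) : Prop :=
  ∀ a ∈ Γ.verts, ∀ b ∈ Γ.verts, Relation.ReflTransGen Γ.Adj a b

/-- `Γ'` is a subgraph of `Γ`. -/
def Subgraph (Γ' Γ : CGraph V s) : Prop :=
  Γ'.verts ⊆ Γ.verts ∧ ∀ r a b, Γ'.E r a b → Γ.E r a b

/-- `C` is a connected component of `Γ`: a maximal connected subgraph. -/
def IsComponent (C Γ : CGraph V s) : Prop :=
  C.Subgraph Γ ∧ C.Connected ∧
    ∀ C' : CGraph V s, C'.Subgraph Γ → C'.Connected → C.Subgraph C' → C'.Subgraph C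

/-- A graph is admissible iff no two distinct edges of the same color begin at the
same vertex or end at the same vertex. -/
def Admissible (Γ : CGraph V s) : Prop :=
  (∀ r a b b', Γ.E r a b → Γ.E r a b' → b = b') ∧
    (∀ r a a' b, Γ.E r a b → Γ.E r a' b → a = a')

/-- `Γ.mono r` is `Γ` with all edges not of color `r` removed. -/
def mono (Γ : CGraph V s) (r : Fin s) : CGraph V s where
  verts := Γ.verts
  finite := Γ.finite
  nonem := Γ.nonem
  E := fun r' a b => r' = r ∧ Γ.E r' a b
  memL := fun r' a b h => Γ.memL r' a b h.2
  memR := fun r' a b h => Γ.memR r' a b h.2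

/-- An `r`-path of `Γ` is a non-trivial connected component of `Γ.mono r`. -/
def IsRPath (P Γ : CGraph V s) (r : Fin s) : Prop :=
  P.IsComponent (Γ.mono r) ∧ ¬ P.Trivial

/-- A path of `Γ` is an `r`-path for some color `r`. -/
def IsPathOf (P Γ : CGraph V s) : Prop := ∃ r, P.IsRPath Γ r

/-- A path is closed (a closed circuit) iff every one of its vertices has an
outgoing edge. -/
def Closed (P : CGraph V s) : Prop := ∀ a ∈ P.verts, ∃ r b, P.E r a b

/-- A loop of `Γ` is a path of `Γ` which is a closed circuit. -/
def IsLoopOf (P Γ : CGraph V s) : Prop := P.IsPathOf Γ ∧ P.Closed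

/-- A string of `Γ` is a path of `Γ` which is not a loop. -/
def IsStringOf (P Γ : CGraph V s) : Prop := P.IsPathOf Γ ∧ ¬ P.Closed

/-- The number of edges of `Γ` (counting colors). -/
def edgeCount (Γ : CGraph V s) : ℕ :=
  Nat.card {p : Fin s × V × V // Γ.E p.1 p.2.1 p.2.2}

/-- The number of loops (of any color) of `Γ`. -/
def loopCount (Γ : CGraph V s) : ℕ :=
  Nat.card {P : CGraph V s // P.IsLoopOf Γ}

/-- The number of vertices of `Γ`. -/
def vertCount (Γ : CGraph V s) : ℕ := Nat.card Γ.verts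

/-- The loop-characteristic `χ(Γ) = V(Γ) - E(Γ) + L(Γ)`. -/
def chi (Γ : CGraph V s) : ℤ :=
  (Γ.vertCount : ℤ) - (Γ.edgeCount : ℤ) + (Γ.loopCount : ℤ)

/-- `Γ.erase P` is the graph obtained from `Γ` by removing all edges of `P`. -/
def erase (Γ P : CGraph V s) : CGraph V s where
  verts := Γ.verts
  finite := Γ.finite
  nonem := Γ.nonem
  E := fun r a b => Γ.E r a b ∧ ¬ P.E r a b
  memL := fun r a b h => Γ.memL r a b h.1
  memR := fun r a b h => Γ.memR r a b h.1

/-- A graph is strongly admissible (w.r.t. `d : Fin s → ℕ∞`) iff it is admissible,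
every `r`-loop has length `d r`, and every `r`-string has length `< d r`. -/
def StronglyAdmissible (d : Fin s → ℕ∞) (Γ : CGraph V s) : Prop :=
  Γ.Admissible ∧ ∀ r P, IsRPath P Γ r →
    (P.Closed → (P.edgeCount : ℕ∞) = d r) ∧ (¬ P.Closed → (P.edgeCount : ℕ∞) < d r)

/-- The quotient of `Γ` by a partition (setoid) `π` of the ambient vertex type. -/
def quot (Γ : CGraph V s) (π : Setoid V) : CGraph (Quotient π) s where
  verts := Quotient.mk π '' Γ.verts
  finite := Γ.finite.image _
  nonem := Γ.nonem.image _
  E := fun r A B => ∃ a b, Γ.E r a b ∧ Quotient.mk π a = A ∧ Quotient.mk π b = B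
  memL := fun r A B h => by
    obtain ⟨a, b, he, ha, hb⟩ := h
    exact ⟨a, Γ.memL r a b he, ha⟩
  memR := fun r A B h => by
    obtain ⟨a, b, he, ha, hb⟩ := h
    exact ⟨b, Γ.memR r a b he, hb⟩

/-- `π` is a congruence of `Γ`: for any two edges of the same color, the source
blocks agree iff the target blocks agree. -/
def IsCongruence (Γ : CGraph V s) (π : Setoid V) : Prop :=
  ∀ r a₁ b₁ a₂ b₂, Γ.E r a₁ b₁ → Γ.E r a₂ b₂ → (π.r a₁ a₂ ↔ π.r b₁ b₂)

/-- `π` is a strong congruence of `Γ`: a congruence whose quotient is strongly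
admissible. -/
def IsStrongCongruence (d : Fin s → ℕ∞) (Γ : CGraph V s) (π : Setoid V) : Prop :=
  Γ.IsCongruence π ∧ (Γ.quot π).StronglyAdmissible d

/-- Isomorphism of edge-colored graphs: a bijection between the vertex sets
preserving the `r`-edges in both directions, for every color `r`. -/
def Iso (Γ₁ : CGraph V s) (Γ₂ : CGraph W s) : Prop :=
  ∃ Φ : V → W, Set.BijOn Φ Γ₁.verts Γ₂.verts ∧
    ∀ r a b, a ∈ Γ₁.verts → b ∈ Γ₁.verts → (Γ₂.E r (Φ a) (Φ b) ↔ Γ₁.E r a b)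

end CGraph

noncomputable section

open Filter Topology

/-- `permSet A N` is `S_N^(A)`: the set of permutations of `{1,…,N}` (modeled as
`Fin N`) all of whose cycles have length belonging to `A`; the length of the cycle
of `σ` containing `i` is the minimal period of `i` under `σ`. -/
def permSet (A : Set ℕ) (N : ℕ) : Set (Equiv.Perm (Fin N)) :=
  {σ | ∀ i : Fin N, Function.minimalPeriod (⇑σ) i ∈ A}

/-- `pN A k N` is `p_N^(A)(k)`: the probability that, in a uniformly random
permutation from `S_N^(A)`, the first element belongs to a cycle of length `k`. -/
def pN (A : Set ℕ) (k N : ℕ) : ℝ :=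
  (Nat.card {σ : Equiv.Perm (Fin N) // σ ∈ permSet A N ∧
      ∃ i : Fin N, (i : ℕ) = 0 ∧ Function.minimalPeriod (⇑σ) i = k} : ℝ) /
    (Nat.card ↥(permSet A N) : ℝ)

namespace CGraph

/-- The quotient of `Γ` by a partition (setoid) `π` of its vertex set. -/
def quot' {V : Type} {s : ℕ} (Γ : CGraph V s) (π : Setoid ↥Γ.verts) :
    CGraph (Quotient π) s where
  verts := Set.univ
  finite := by
    haveI : Finite ↥Γ.verts := Γ.finite.to_subtype
    haveI : Finite (Quotient π) := Quotient.finite π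
    exact Set.finite_univ
  nonem := by
    obtain ⟨a, ha⟩ := Γ.nonem
    exact ⟨Quotient.mk π ⟨a, ha⟩, Set.mem_univ _⟩
  E := fun r A B => ∃ a b : ↥Γ.verts, Γ.E r a.1 b.1 ∧
    Quotient.mk π a = A ∧ Quotient.mk π b = B
  memL := fun _ _ _ _ => Set.mem_univ _
  memR := fun _ _ _ _ => Set.mem_univ _

/-- `π` (a partition of the vertex set of `Γ`) is a congruence of `Γ`. -/
def IsCongruence' {V : Type} {s : ℕ} (Γ : CGraph V s) (π : Setoid ↥Γ.verts) : Prop :=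
  ∀ (r : Fin s) (a₁ b₁ a₂ b₂ : ↥Γ.verts), Γ.E r a₁.1 b₁.1 → Γ.E r a₂.1 b₂.1 →
    (π.r a₁ a₂ ↔ π.r b₁ b₂)

end CGraph

/-- `Δ` is an `A`-graph (with `dA = sup A`): a monocolored admissible graph all of
whose loops have length in `A` and all of whose strings have length `< sup A`. -/
def IsAGraph {W : Type} {s : ℕ} (A : Set ℕ) (dA : ℕ∞) (Δ : CGraph W s) : Prop :=
  Δ.Admissible ∧ (∀ P : CGraph W s, P.IsLoopOf Δ → P.edgeCount ∈ A) ∧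
    ∀ P : CGraph W s, P.IsStringOf Δ → (P.edgeCount : ℕ∞) < dA

/-- `pGraph A N Δ` is `p_N^(A)(Δ)`: the probability that a uniformly random
permutation from `S_N^(A)` is compatible with `f(Δ)` for an injective relabeling
`f` of the vertices of `Δ` by elements of `{1,…,N}` (this probability does not
depend on `f`, so we average over all pairs `(f, σ)`). -/
def pGraph {W : Type} {s : ℕ} (A : Set ℕ) (N : ℕ) (Δ : CGraph W s) : ℝ :=
  (Nat.card {q : (↥Δ.verts → Fin N) × Equiv.Perm (Fin N) //
      Function.Injective q.1 ∧ q.2 ∈ permSet A N ∧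
        ∀ (r : Fin s) (a b : ↥Δ.verts), Δ.E r a.1 b.1 → q.2 (q.1 a) = q.1 b} : ℝ) /
    ((Nat.card {f : ↥Δ.verts → Fin N // Function.Injective f} : ℝ) *
      (Nat.card ↥(permSet A N) : ℝ))

open Filter Topology
namespace PG
open Function

/-- injective semiconjugacy preserves minimal periods -/
theorem minPer_semiconj {X Y : Type} {σ : X → X} {π : Y → Y} {f : Y → X} (hf : Injective f)
    (h : ∀ y, σ (f y) = f (π y)) (y : Y) : minimalPeriod σ (f y) = minimalPeriod π y := by
  rw [minimalPeriod_eq_minimalPeriod_iff]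
  intro n
  have : ∀ n y, σ^[n] (f y) = f (π^[n] y) := by
    intro n
    induction n with
    | zero => intro y; rfl
    | succ n ih => intro y; rw [iterate_succ_apply, iterate_succ_apply, h, ih]
  simp only [IsPeriodicPt, IsFixedPt, this, hf.eq_iff]

open Classical in
/-- the finset of permutations with cycle lengths in `A` -/
noncomputable def PS (A : Set ℕ) (X : Type) [Fintype X] : Finset (Equiv.Perm X) :=
  Finset.univ.filter fun σ => ∀ i, minimalPeriod σ i ∈ A

open Classical in
/-- number of points in `j`-cycles -/
noncomputable def Jc {X : Type} [Fintype X] (j : ℕ) (σ : Equiv.Perm X) : ℕ :=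
  (Finset.univ.filter fun x => minimalPeriod σ x = j).card

theorem exists_ext {L : Type} [Fintype L] {N M : ℕ} (hN : N = Fintype.card L + M)
    (f : L → Fin N) (hf : Injective f) :
    ∃ e : L ⊕ Fin M ≃ Fin N, ∀ l, e (Sum.inl l) = f l := by
  classical
  have hc : Fintype.card ↥((Set.range f)ᶜ) = M := by
    rw [Fintype.card_compl_set, Fintype.card_fin, Set.card_range_of_injective hf]; omega
  refine ⟨(Equiv.sumCongr (Equiv.ofInjective f hf) (Fintype.equivFinOfCardEq hc).symm).trans
    (Equiv.Set.sumCompl (Set.range f)), fun l => ?_⟩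
  simp

open Classical in
theorem core (A : Set ℕ) {L : Type} [Fintype L] (π : Equiv.Perm L)
    (hπ : ∀ l, minimalPeriod π l ∈ A)
    {N M : ℕ} (hN : N = Fintype.card L + M) (f : L → Fin N) (hf : Injective f) :
    ∃ Φ : Equiv.Perm (Fin M) → Equiv.Perm (Fin N), Injective Φ ∧
      (PS A (Fin M)).image Φ = (PS A (Fin N)).filter (fun σ => ∀ l, σ (f l) = f (π l)) ∧
      ∀ j τ, Jc j (Φ τ) = Jc j π + Jc j τ := by
  obtain ⟨e, he⟩ := exists_ext hN f hf
  have h1 : ∀ τ : Equiv.Perm (Fin M), ∀ l,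
      minimalPeriod (e.permCongr (Equiv.Perm.sumCongr π τ)) (e (Sum.inl l)) = minimalPeriod π l := by
    intro τ l
    exact minPer_semiconj (f := fun l => e (Sum.inl l)) (fun a b h => by simpa using h)
      (fun y => by simp) l
  have h2 : ∀ τ : Equiv.Perm (Fin M), ∀ l,
      minimalPeriod (e.permCongr (Equiv.Perm.sumCongr π τ)) (e (Sum.inr l)) = minimalPeriod τ l := by
    intro τ l
    exact minPer_semiconj (f := fun l => e (Sum.inr l)) (fun a b h => by simpa using h)
      (fun y => by simp) l
  refine ⟨fun τ => e.permCongr (Equiv.Perm.sumCongr π τ), ?_, ?_, ?_⟩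
  · intro τ τ' h
    have := e.permCongr.injective h
    ext y
    have h3 := congrArg (fun g : Equiv.Perm (L ⊕ Fin M) => g (Sum.inr y)) this
    simp at h3
    rw [h3]
  · ext σ
    simp only [Finset.mem_image, Finset.mem_filter, PS, Finset.mem_univ, true_and]
    constructor
    · rintro ⟨τ, hτ, rfl⟩
      refine ⟨fun i => ?_, fun l => ?_⟩
      · obtain ⟨x, rfl⟩ := e.surjective i
        rcases x with l | y
        · rw [h1]; exact hπ l
        · rw [h2]; exact hτ y
      · rw [← he, ← he]; simp
    · rintro ⟨hσ, hc⟩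
      have hm : Set.MapsTo (e.symm.permCongr σ) (Set.range Sum.inl) (Set.range Sum.inl) := by
        rintro _ ⟨l, rfl⟩
        refine ⟨π l, ?_⟩
        rw [Equiv.permCongr_apply, Equiv.symm_symm, he, hc, ← he]; simp
      obtain ⟨⟨π', τ⟩, hτ⟩ := Equiv.Perm.mem_sumCongrHom_range_of_perm_mapsTo_inl hm
      have hππ : π' = π := by
        ext l
        have := congrArg (fun g : Equiv.Perm (L ⊕ Fin M) => g (Sum.inl l)) hτ
        simp [Equiv.permCongr_apply, he, hc] at this
        rw [← he (π l)] at this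
        simpa using this
      subst hππ
      have hσe : σ = e.permCongr (Equiv.Perm.sumCongr π' τ) := by
        have : Equiv.Perm.sumCongr π' τ = e.symm.permCongr σ := hτ
        rw [this]; ext; simp [Equiv.permCongr_apply]
      refine ⟨τ, fun i => ?_, hσe.symm⟩
      have := hσ (e (Sum.inr i))
      rwa [hσe, h2] at this
  · intro j τ
    simp only [Jc]
    rw [← Finset.card_disjSum]
    symm
    refine Finset.card_bij (fun x _ => e x) ?_ (fun a _ b _ h => e.injective h) ?_
    · rintro (l | y) h
      · simp at h; simp [h1, h]
      · simp at h; simp [h2, h]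
    · intro b hb
      obtain ⟨x, rfl⟩ := e.surjective b
      refine ⟨x, ?_, rfl⟩
      rcases x with l | y
      · simp [h1] at hb; simp [hb]
      · simp [h2] at hb; simp [hb]

end PG

open Filter Topology
namespace PG
open Function

theorem minPer_pos {X : Type} [Finite X] (σ : Equiv.Perm X) (x : X) : 0 < minimalPeriod σ x := by
  apply minimalPeriod_pos_of_mem_periodicPts
  exact σ.injective.mem_periodicPts x

open Classical in
theorem Jc_eq_card {X : Type} [Fintype X] (j : ℕ) [NeZero j] (σ : Equiv.Perm X) :
    Jc j σ = (Finset.univ.filter fun f : ZMod j → X => Injective f ∧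
      ∀ i, σ (f i) = f (Equiv.addRight (1 : ZMod j) i)).card := by
  have hrot : ∀ i : ZMod j, minimalPeriod (Equiv.addRight (1 : ZMod j)) i = j := by
    intro i
    have hit : ∀ n : ℕ, ∀ i : ZMod j, (Equiv.addRight (1 : ZMod j))^[n] i = i + n := by
      intro n
      induction n with
      | zero => intro i; simp
      | succ n ih => intro i; rw [iterate_succ_apply, ih]; simp; ring
    apply Nat.dvd_antisymm
    · apply IsPeriodicPt.minimalPeriod_dvd
      simp [IsPeriodicPt, IsFixedPt, hit]
    · have := isPeriodicPt_minimalPeriod (Equiv.addRight (1 : ZMod j)) i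
      simp only [IsPeriodicPt, IsFixedPt, hit] at this
      rw [add_eq_left] at this
      exact (ZMod.natCast_eq_zero_iff _ _).1 this
  unfold Jc
  refine Finset.card_bij' (fun x _ => fun i : ZMod j => σ^[i.val] x) (fun f _ => f 0) ?_ ?_ ?_ ?_
  · intro x hx
    simp only [Finset.mem_filter, Finset.mem_univ, true_and] at hx ⊢
    refine ⟨fun a b h => ?_, fun i => ?_⟩
    · have := iterate_injOn_Iio_minimalPeriod (f := σ) (x := x)
      apply ZMod.val_injective
      apply this _ _ h
      · simpa [hx] using ZMod.val_lt a
      · simpa [hx] using ZMod.val_lt b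
    · rw [← iterate_succ_apply' σ]
      rw [← iterate_mod_minimalPeriod_eq (n := i.val.succ), hx]
      congr 1
      simp only [Equiv.coe_addRight]
      rw [ZMod.val_add, ZMod.val_one_eq_one_mod, Nat.add_mod_mod]
  · intro f hf
    simp only [Finset.mem_filter, Finset.mem_univ, true_and] at hf ⊢
    rw [minPer_semiconj hf.1 hf.2, hrot]
  · intro x hx
    simp
  · intro f hf
    simp only [Finset.mem_filter, Finset.mem_univ, true_and] at hf
    have : ∀ n : ℕ, σ^[n] (f 0) = f n := by
      intro n
      induction n with
      | zero => simp
      | succ n ih => rw [iterate_succ_apply', ih, hf.2]; simp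
    funext i
    rw [this]; simp

theorem card_inj (L : Type) [Fintype L] (N : ℕ) [Fintype (L → Fin N)] [DecidablePred fun f : L → Fin N => Injective f] :
    (Finset.univ.filter fun f : L → Fin N => Injective f).card
      = N.descFactorial (Fintype.card L) := by
  classical
  have := Fintype.card_embedding_eq (α := L) (β := Fin N)
  rw [Fintype.card_fin] at this
  rw [← this, ← Fintype.card_subtype]
  exact Fintype.card_congr (Equiv.subtypeInjectiveEquivEmbedding _ _)

theorem Jsum (A : Set ℕ) (j : ℕ) (hj : 0 < j) (hjA : j ∈ A) (N : ℕ) (h : ℕ → ℝ) :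
    ∑ σ ∈ PS A (Fin N), (Jc j σ : ℝ) * h (Jc j σ - j) =
      N.descFactorial j * ∑ τ ∈ PS A (Fin (N - j)), h (Jc j τ) := by
  classical
  haveI : NeZero j := ⟨hj.ne'⟩
  set π : Equiv.Perm (ZMod j) := Equiv.addRight (1 : ZMod j) with hπ
  have hJπ : Jc j π = j := by
    rw [Jc, Finset.filter_true_of_mem]
    · simp
    · intro i _
      have hit : ∀ n : ℕ, ∀ i : ZMod j, (Equiv.addRight (1 : ZMod j))^[n] i = i + n := by
        intro n
        induction n with
        | zero => intro i; simp
        | succ n ih => intro i; rw [iterate_succ_apply, ih]; simp; ring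
      apply Nat.dvd_antisymm
      · apply IsPeriodicPt.minimalPeriod_dvd
        simp [IsPeriodicPt, IsFixedPt, hit, hπ]
      · have := isPeriodicPt_minimalPeriod (Equiv.addRight (1 : ZMod j)) i
        simp only [IsPeriodicPt, IsFixedPt, hit] at this
        rw [add_eq_left] at this
        exact (ZMod.natCast_eq_zero_iff _ _).1 this
  have hper : ∀ l, minimalPeriod π l ∈ A := by
    intro l
    have : Jc j π = Fintype.card (ZMod j) := by rw [hJπ, ZMod.card]
    rw [Jc, Finset.card_eq_iff_eq_univ, Finset.filter_eq_self] at this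
    rw [this l (Finset.mem_univ _)]; exact hjA
  have step1 : ∑ σ ∈ PS A (Fin N), (Jc j σ : ℝ) * h (Jc j σ - j) =
      ∑ f ∈ Finset.univ.filter (fun f : ZMod j → Fin N => Injective f),
        ∑ σ ∈ (PS A (Fin N)).filter (fun σ => ∀ l, σ (f l) = f (π l)), h (Jc j σ - j) := by
    simp_rw [Finset.sum_filter (s := PS A (Fin N))]
    rw [Finset.sum_comm]
    refine Finset.sum_congr rfl fun σ _ => ?_
    rw [← Finset.sum_filter, Finset.filter_filter, Finset.sum_const, nsmul_eq_mul]
    congr 1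
    rw [Jc_eq_card]
    congr!
  rw [step1]
  have step2 : ∀ f ∈ Finset.univ.filter (fun f : ZMod j → Fin N => Injective f),
      ∑ σ ∈ (PS A (Fin N)).filter (fun σ => ∀ l, σ (f l) = f (π l)), h (Jc j σ - j) =
      ∑ τ ∈ PS A (Fin (N - j)), h (Jc j τ) := by
    intro f hf
    have hf : Injective f := by simpa using hf
    have hle := Fintype.card_le_of_injective f hf
    rw [ZMod.card, Fintype.card_fin] at hle
    obtain ⟨Φ, hΦ, him, hJ⟩ := core A π hper (N := N) (M := N - j)
      (by rw [ZMod.card]; omega) f hf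
    rw [← him, Finset.sum_image (fun _ _ _ _ h => hΦ h)]
    refine Finset.sum_congr rfl fun τ _ => ?_
    rw [hJ, hJπ, Nat.add_sub_cancel_left]
  rw [Finset.sum_congr rfl step2, Finset.sum_const, nsmul_eq_mul, card_inj, ZMod.card]

end PG

open Filter Topology
namespace PG
open Function

/-- `a_N / N!` -/
noncomputable def cc (A : Set ℕ) (N : ℕ) : ℝ := ((PS A (Fin N)).card : ℝ) / (N.factorial : ℝ)

/-- normalised sums over permutations of a function of the number of points in `j`-cycles -/
noncomputable def mm (A : Set ℕ) (j N : ℕ) (h : ℕ → ℝ) : ℝ :=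
  (∑ σ ∈ PS A (Fin N), h (Jc j σ)) / (N.factorial : ℝ)

theorem cc_nonneg (A : Set ℕ) (N : ℕ) : 0 ≤ cc A N := by unfold cc; positivity

theorem cc_le_one (A : Set ℕ) (N : ℕ) : cc A N ≤ 1 := by
  unfold cc
  rw [div_le_one (by positivity)]
  have : (PS A (Fin N)).card ≤ N.factorial := by
    classical
    calc _ ≤ (Finset.univ : Finset (Equiv.Perm (Fin N))).card := Finset.card_le_univ _
      _ = _ := by rw [Finset.card_univ, Fintype.card_perm, Fintype.card_fin]
  exact_mod_cast this

theorem cc_zero (A : Set ℕ) : cc A 0 = 1 := by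
  classical
  unfold cc PS
  rw [Finset.filter_true_of_mem]
  · simp
  · intro σ _ i; exact i.elim0

theorem cc_pos_iff (A : Set ℕ) (N : ℕ) : 0 < cc A N ↔ (permSet A N).Nonempty := by
  unfold cc
  rw [div_pos_iff_of_pos_right (by positivity), Nat.cast_pos, Finset.card_pos]
  constructor
  · rintro ⟨σ, h⟩; exact ⟨σ, by simpa [PS, permSet] using h⟩
  · rintro ⟨σ, h⟩; exact ⟨σ, by simpa [PS, permSet] using h⟩

theorem card_permSet (A : Set ℕ) (N : ℕ) : Nat.card ↥(permSet A N) = (PS A (Fin N)).card := by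
  classical
  rw [Nat.card_coe_set_eq, ← Set.ncard_coe_finset]
  congr 1
  ext σ
  simp [PS, permSet]

theorem mm_one (A : Set ℕ) (j N : ℕ) : mm A j N (fun _ => 1) = cc A N := by
  simp [mm, cc]

theorem mm_step (A : Set ℕ) (j N : ℕ) (hj : 0 < j) (hjA : j ∈ A) (hN : j ≤ N) (h : ℕ → ℝ) :
    mm A j N (fun x => (x : ℝ) * h (x - j)) = mm A j (N - j) h := by
  unfold mm
  rw [Jsum A j hj hjA]
  have : (N.factorial : ℝ) = (N - j).factorial * N.descFactorial j := by
    exact_mod_cast (Nat.factorial_mul_descFactorial hN).symm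
  rw [this]
  have h1 : (N.descFactorial j : ℝ) ≠ 0 := by
    exact_mod_cast (Nat.descFactorial_pos.2 hN).ne'
  field_simp

theorem mm_step' (A : Set ℕ) (j N : ℕ) (hj : 0 < j) (hjA : j ∈ A) (hN : N < j) (h : ℕ → ℝ) :
    mm A j N (fun x => (x : ℝ) * h (x - j)) = 0 := by
  unfold mm
  rw [Jsum A j hj hjA, Nat.descFactorial_eq_zero_iff_lt.2 hN]
  simp

/-- generalised falling factorial with truncated subtraction -/
def fall (j k x : ℕ) : ℕ := ∏ i ∈ Finset.range k, (x - i * j)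

theorem fall_succ (j k x : ℕ) : fall j (k + 1) x = x * fall j k (x - j) := by
  unfold fall
  rw [Finset.prod_range_succ', mul_comm]
  congr 1
  · simp
  · refine Finset.prod_congr rfl fun i _ => ?_
    rw [Nat.sub_sub]; congr 1; ring

theorem mm_fall (A : Set ℕ) (j : ℕ) (hj : 0 < j) (hjA : j ∈ A) (k : ℕ) : ∀ N,
    mm A j N (fun x => (fall j k x : ℝ)) = if j * k ≤ N then cc A (N - j * k) else 0 := by
  induction k with
  | zero => intro N; simp [fall, mm_one]
  | succ k ih =>
    intro N
    have : (fun x => (fall j (k + 1) x : ℝ)) = fun x : ℕ => (x : ℝ) * (fun y : ℕ => (fall j k y : ℝ)) (x - j) := by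
      funext x; rw [fall_succ]; push_cast; rfl
    rw [this]
    by_cases hN : j ≤ N
    · rw [mm_step A j N hj hjA hN (fun y => (fall j k y : ℝ)), ih]
      have e : N - j * (k + 1) = N - j - j * k := by rw [mul_add, Nat.sub_sub]; congr 1; ring
      have e2 : j * (k + 1) ≤ N ↔ j * k ≤ N - j := by rw [mul_add]; omega
      simp [e, e2]
    · rw [mm_step' A j N hj hjA (by omega) (fun y => (fall j k y : ℝ))]
      rw [if_neg]
      intro h; apply hN; nlinarith

theorem mm_id (A : Set ℕ) (j : ℕ) (hj : 0 < j) (hjA : j ∈ A) (N : ℕ) :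
    mm A j N (fun x => (x : ℝ)) = if j ≤ N then cc A (N - j) else 0 := by
  have := mm_fall A j hj hjA 1 N
  simpa [fall] using this

theorem minPer_le {X : Type} [Fintype X] (σ : Equiv.Perm X) (x : X) :
    minimalPeriod σ x ≤ Fintype.card X := minimalPeriod_le_card

theorem Jc_le {X : Type} [Fintype X] (j : ℕ) (σ : Equiv.Perm X) : Jc j σ ≤ Fintype.card X :=
  Finset.card_le_univ _

theorem sum_Jc {N : ℕ} (σ : Equiv.Perm (Fin N)) : ∑ j ∈ Finset.Icc 1 N, Jc j σ = N := by
  classical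
  unfold Jc
  have := Finset.card_eq_sum_card_fiberwise (s := Finset.univ) (t := Finset.Icc 1 N)
    (f := fun x : Fin N => minimalPeriod σ x) (fun x _ => by
      simp only [Finset.coe_Icc, Set.mem_Icc]
      exact ⟨minPer_pos σ x, by simpa using minPer_le σ x⟩)
  simp only [Finset.card_univ, Fintype.card_fin] at this
  rw [this.symm.trans ?_]
  rfl

theorem Jc_eq_zero {A : Set ℕ} {N j : ℕ} (hj : j ∉ A) {σ : Equiv.Perm (Fin N)}
    (hσ : σ ∈ PS A (Fin N)) : Jc j σ = 0 := by
  classical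
  unfold Jc
  rw [Finset.card_eq_zero, Finset.filter_eq_empty_iff]
  intro x _ h
  simp only [PS, Finset.mem_filter] at hσ
  exact hj (h ▸ hσ.2 x)

theorem mm_id_zero (A : Set ℕ) (j : ℕ) (hjA : j ∉ A) (N : ℕ) :
    mm A j N (fun x => (x : ℝ)) = 0 := by
  unfold mm
  rw [Finset.sum_eq_zero, zero_div]
  intro σ hσ
  rw [Jc_eq_zero hjA hσ]; simp

theorem sum_mm (A : Set ℕ) (N : ℕ) :
    ∑ j ∈ Finset.Icc 1 N, mm A j N (fun x => (x : ℝ)) = N * cc A N := by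
  unfold mm cc
  rw [← Finset.sum_div, Finset.sum_comm, ← mul_div_assoc]
  congr 1
  rw [mul_comm, ← nsmul_eq_mul, ← Finset.sum_const]
  refine Finset.sum_congr rfl fun σ _ => ?_
  have := sum_Jc σ
  beta_reduce
  exact_mod_cast this

open Classical in
theorem recur (A : Set ℕ) (N : ℕ) :
    (N : ℝ) * cc A N = ∑ j ∈ Finset.Icc 1 N, if j ∈ A then cc A (N - j) else 0 := by
  rw [← sum_mm]
  refine Finset.sum_congr rfl fun j hj => ?_
  rw [Finset.mem_Icc] at hj
  split_ifs with h
  · rw [mm_id A j hj.1 h, if_pos hj.2]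
  · exact mm_id_zero A j h N

end PG

open Filter Topology
namespace PG
open Function

open Classical in
/-- indicator of `n + 1 ∈ S` -/
noncomputable def bi (S : Set ℕ) (n : ℕ) : ℝ := if n + 1 ∈ S then 1 else 0

theorem bi_nonneg (S : Set ℕ) (n : ℕ) : 0 ≤ bi S n := by unfold bi; split_ifs <;> norm_num

theorem recur_range (S : Set ℕ) (n : ℕ) :
    cc S (n + 1) * ((n : ℝ) + 1) = ∑ k ∈ Finset.range (n + 1), cc S k * bi S (n - k) := by
  classical
  have := recur S (n + 1)
  push_cast at this
  rw [mul_comm, this]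
  refine Finset.sum_nbij' (fun j => n + 1 - j) (fun k => n + 1 - k) ?_ ?_ ?_ ?_ ?_
  · intro j hj; simp at hj ⊢; omega
  · intro j hj; simp at hj ⊢; omega
  · intro j hj; simp at hj ⊢; omega
  · intro j hj; simp at hj ⊢; omega
  · intro j hj
    simp at hj
    have : n - (n + 1 - j) + 1 = j := by omega
    simp [bi, this]

theorem dC (S : Set ℕ) : PowerSeries.derivative ℝ (PowerSeries.mk (cc S))
    = PowerSeries.mk (cc S) * PowerSeries.mk (bi S) := by
  ext n
  rw [PowerSeries.coeff_derivative, PowerSeries.coeff_mul,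
    Finset.Nat.sum_antidiagonal_eq_sum_range_succ_mk]
  simp only [PowerSeries.coeff_mk]
  exact recur_range S n

theorem summable_cc (B : Set ℕ) (hB : Summable (B.indicator fun j => (1 : ℝ) / j)) :
    Summable (cc B) := by
  classical
  have hb : Summable fun k : ℕ => bi B k / ((k : ℝ) + 1) := by
    have := (summable_nat_add_iff 1).2 hB
    refine this.congr fun k => ?_
    unfold bi
    by_cases h : k + 1 ∈ B <;> simp [h]
  have hle : ∀ m k : ℕ, bi B k / ((m : ℝ) + k + 1) ≤ bi B k / ((k : ℝ) + 1) := by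
    intro m k
    apply div_le_div_of_nonneg_left (bi_nonneg B k) (by positivity)
    have : (0 : ℝ) ≤ m := by positivity
    linarith
  have hnn : ∀ m k : ℕ, 0 ≤ bi B k / ((m : ℝ) + k + 1) := fun m k =>
    div_nonneg (bi_nonneg B k) (by positivity)
  have hbm : ∀ m : ℕ, Summable fun k : ℕ => bi B k / ((m : ℝ) + k + 1) := fun m =>
    Summable.of_nonneg_of_le (hnn m) (hle m) hb
  set β : ℕ → ℝ := fun m => ∑' k : ℕ, bi B k / ((m : ℝ) + k + 1) with hβ
  have hβ0 : ∀ m, 0 ≤ β m := fun m => tsum_nonneg (hnn m)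
  have hβt : Tendsto β atTop (𝓝 0) := by
    have := tendsto_tsum_of_dominated_convergence (𝓕 := atTop) (G := ℝ)
      (f := fun (m : ℕ) (k : ℕ) => bi B k / ((m : ℝ) + k + 1)) (g := fun _ => (0 : ℝ)) hb
      (fun k => by
        apply Tendsto.div_atTop tendsto_const_nhds
        apply tendsto_atTop_add_const_right
        apply tendsto_atTop_add_const_right
        exact tendsto_natCast_atTop_atTop)
      (Eventually.of_forall fun m k => by
        rw [Real.norm_of_nonneg (hnn m k)]; exact hle m k)
    simpa using this
  obtain ⟨m0, hm0⟩ := eventually_atTop.1 (hβt.eventually (gt_mem_nhds (show (0 : ℝ) < 1 / 2 by norm_num)))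
  set K := ∑ m ∈ Finset.range m0, β m with hK
  have hK0 : 0 ≤ K := Finset.sum_nonneg fun m _ => hβ0 m
  have key : ∀ n, ∑ m ∈ Finset.range n, cc B (m + 1) ≤
      1 / 2 * ∑ m ∈ Finset.range n, cc B m + K := by
    intro n
    have e1 : ∑ m ∈ Finset.range n, cc B (m + 1) = ∑ m ∈ Finset.range n,
        ∑ k ∈ Finset.range (m + 1), cc B k * (bi B (m - k) / ((k : ℝ) + (m - k : ℕ) + 1)) := by
      refine Finset.sum_congr rfl fun m _ => ?_
      have h1 : (m : ℝ) + 1 ≠ 0 := by positivity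
      rw [← mul_left_inj' h1, recur_range, Finset.sum_mul]
      refine Finset.sum_congr rfl fun k hk => ?_
      have hk : k ≤ m := by simpa [Nat.lt_succ_iff] using hk
      rw [Nat.cast_sub hk]
      have : (k : ℝ) + (m - k) + 1 = m + 1 := by ring
      rw [this]; field_simp
    rw [e1, Finset.sum_range_diag_flip n
      (fun k l => cc B k * (bi B l / ((k : ℝ) + (l : ℕ) + 1)))]
    calc _ ≤ ∑ m ∈ Finset.range n, cc B m * β m := by
          refine Finset.sum_le_sum fun m _ => ?_
          rw [← Finset.mul_sum]
          apply mul_le_mul_of_nonneg_left _ (cc_nonneg B m)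
          exact (hbm m).sum_le_tsum _ (fun k _ => hnn m k)
      _ ≤ ∑ m ∈ Finset.range n, (1 / 2 * cc B m + if m < m0 then β m else 0) := by
          refine Finset.sum_le_sum fun m _ => ?_
          have h1 := cc_nonneg B m
          have h2 := cc_le_one B m
          have h3 := hβ0 m
          split_ifs with h
          · nlinarith
          · have := hm0 m (by omega); nlinarith
      _ ≤ _ := by
          rw [Finset.sum_add_distrib, ← Finset.mul_sum]
          gcongr
          rw [← Finset.sum_filter]
          apply Finset.sum_le_sum_of_subset_of_nonneg
          · intro m hm; simp at hm; simpa using hm.2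
          · intro m _ _; exact hβ0 m
  refine summable_of_sum_range_le (c := 2 * (1 + K)) (cc_nonneg B) fun n => ?_
  induction n with
  | zero => simp; linarith
  | succ n ih =>
    rw [Finset.sum_range_succ', cc_zero]
    have := key n
    linarith

theorem inf_case (A : Set ℕ) (hB : Summable ((Aᶜ : Set ℕ).indicator fun j => (1 : ℝ) / j)) :
    ∃ l : ℝ, 0 < l ∧ Tendsto (cc A) atTop (𝓝 l) := by
  classical
  set G := PowerSeries.mk (cc Aᶜ) with hG
  set C := PowerSeries.mk (cc A) with hC
  set E : PowerSeries ℝ := (1 - PowerSeries.X) * C with hE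
  have hP : PowerSeries.mk (bi A) + PowerSeries.mk (bi Aᶜ) = PowerSeries.mk (1 : ℕ → ℝ) := by
    ext n
    simp only [map_add, PowerSeries.coeff_mk, bi]
    by_cases h : n + 1 ∈ A <;> simp [h]
  have hP1 : PowerSeries.mk (1 : ℕ → ℝ) * (1 - PowerSeries.X) = 1 :=
    PowerSeries.mk_one_mul_one_sub_eq_one ℝ
  have hdE : PowerSeries.derivative ℝ E = - (E * PowerSeries.mk (bi Aᶜ)) := by
    rw [hE, Derivation.leibniz, dC]
    simp only [map_sub, PowerSeries.derivative_X, Derivation.map_one_eq_zero, smul_eq_mul]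
    have : PowerSeries.mk (bi A) = PowerSeries.mk (1 : ℕ → ℝ) - PowerSeries.mk (bi Aᶜ) := by
      rw [← hP]; ring
    rw [← hC, this]
    linear_combination C * hP1
  have hEG : E * G = 1 := by
    apply PowerSeries.derivative.ext
    · rw [Derivation.leibniz, hdE, dC]
      simp only [smul_eq_mul, Derivation.map_one_eq_zero]
      ring
    · simp [hE, hC, hG, cc_zero]
  set e : ℕ → ℝ := fun n => PowerSeries.coeff n E with he
  have hrec : ∀ n : ℕ, e (n + 1) * ((n : ℝ) + 1) =
      - ∑ k ∈ Finset.range (n + 1), e k * bi Aᶜ (n - k) := by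
    intro n
    have := congrArg (PowerSeries.coeff n) hdE
    rw [PowerSeries.coeff_derivative, map_neg, PowerSeries.coeff_mul n E (PowerSeries.mk (bi Aᶜ)),
      Finset.Nat.sum_antidiagonal_eq_sum_range_succ_mk] at this
    simpa only [PowerSeries.coeff_mk] using this
  have hele : ∀ n, |e n| ≤ cc Aᶜ n := by
    intro n
    induction n using Nat.strong_induction_on with
    | _ n ih =>
      rcases n with _ | n
      · simp [he, hE, hC, cc_zero]
      · have h1 : (0 : ℝ) < (n : ℝ) + 1 := by positivity
        rw [← mul_le_mul_iff_left₀ h1, recur_range]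
        calc |e (n + 1)| * ((n : ℝ) + 1) = |e (n + 1) * ((n : ℝ) + 1)| := by
              rw [abs_mul, abs_of_pos h1]
          _ = |∑ k ∈ Finset.range (n + 1), e k * bi Aᶜ (n - k)| := by rw [hrec, abs_neg]
          _ ≤ ∑ k ∈ Finset.range (n + 1), |e k * bi Aᶜ (n - k)| := Finset.abs_sum_le_sum_abs _ _
          _ ≤ _ := by
            refine Finset.sum_le_sum fun k hk => ?_
            rw [abs_mul, abs_of_nonneg (bi_nonneg _ _)]
            exact mul_le_mul_of_nonneg_right (ih k (by simpa using hk)) (bi_nonneg _ _)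
  have hg := summable_cc Aᶜ hB
  have hen : Summable fun n => ‖e n‖ := Summable.of_nonneg_of_le (fun _ => norm_nonneg _) hele hg
  have hgn : Summable fun n => ‖cc Aᶜ n‖ := hg.norm
  have hprod := tsum_mul_tsum_eq_tsum_sum_antidiagonal_of_summable_norm hen hgn
  have hone : (∑' n, e n) * (∑' n, cc Aᶜ n) = 1 := by
    rw [hprod]
    have : ∀ n, ∑ kl ∈ Finset.HasAntidiagonal.antidiagonal n, e kl.1 * cc Aᶜ kl.2 = if n = 0 then 1 else 0 := by
      intro n
      have := congrArg (PowerSeries.coeff n) hEG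
      rw [PowerSeries.coeff_mul n E G, PowerSeries.coeff_one] at this
      simpa only [hG, PowerSeries.coeff_mk] using this
    simp_rw [this]
    simp
  have hsumc : ∀ n, ∑ k ∈ Finset.range (n + 1), e k = cc A n := by
    intro n
    induction n with
    | zero => simp [he, hE, hC]
    | succ n ih =>
      rw [Finset.sum_range_succ, ih]
      simp [he, hE, hC, sub_mul, PowerSeries.coeff_succ_X_mul]
  have htend : Tendsto (cc A) atTop (𝓝 (∑' n, e n)) := by
    have := (hen.of_norm.hasSum.tendsto_sum_nat).comp (tendsto_add_atTop_nat 1)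
    refine this.congr fun n => ?_
    exact hsumc n
  refine ⟨_, lt_of_le_of_ne (ge_of_tendsto' htend (cc_nonneg A)) ?_, htend⟩
  intro h
  rw [← h] at hone
  simp at hone

end PG

open Filter Topology
namespace PG
open Function

/-- expectation of a function of the number of points in `j`-cycles -/
noncomputable def Ex (A : Set ℕ) (j N : ℕ) (h : ℕ → ℝ) : ℝ :=
  ∑ σ ∈ PS A (Fin N), ((PS A (Fin N)).card : ℝ)⁻¹ * h (Jc j σ)

theorem Ex_eq (A : Set ℕ) (j N : ℕ) (h : ℕ → ℝ) : Ex A j N h = mm A j N h / cc A N := by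
  unfold Ex mm cc
  rw [← Finset.mul_sum, div_div_div_cancel_right₀ (by positivity)]
  field_simp

theorem Ex_mono (A : Set ℕ) (j N : ℕ) {h h' : ℕ → ℝ} (hh : ∀ x, x ≤ N → h x ≤ h' x) :
    Ex A j N h ≤ Ex A j N h' := by
  unfold Ex
  refine Finset.sum_le_sum fun σ _ => ?_
  apply mul_le_mul_of_nonneg_left _ (by positivity)
  apply hh
  simpa using Jc_le j σ

theorem Ex_add (A : Set ℕ) (j N : ℕ) (h h' : ℕ → ℝ) :
    Ex A j N (fun x => h x + h' x) = Ex A j N h + Ex A j N h' := by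
  unfold Ex
  rw [← Finset.sum_add_distrib]
  exact Finset.sum_congr rfl fun σ _ => by ring

theorem Ex_smul (A : Set ℕ) (j N : ℕ) (c : ℝ) (h : ℕ → ℝ) :
    Ex A j N (fun x => c * h x) = c * Ex A j N h := by
  unfold Ex
  rw [Finset.mul_sum]
  exact Finset.sum_congr rfl fun σ _ => by ring

theorem card_ne {A : Set ℕ} {N : ℕ} (hN : 0 < cc A N) : ((PS A (Fin N)).card : ℝ) ≠ 0 := by
  intro h; unfold cc at hN; rw [h] at hN; simp at hN

theorem Ex_const {A : Set ℕ} {j N : ℕ} (hN : 0 < cc A N) (c : ℝ) :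
    Ex A j N (fun _ => c) = c := by
  unfold Ex
  rw [Finset.sum_const, nsmul_eq_mul, ← mul_assoc, mul_inv_cancel₀ (card_ne hN), one_mul]

theorem Ex_pow {A : Set ℕ} {j N : ℕ} (hN : 0 < cc A N) (h : ℕ → ℝ) (hh : ∀ x, 0 ≤ h x) (n : ℕ) :
    (Ex A j N h) ^ n ≤ Ex A j N (fun x => h x ^ n) := by
  unfold Ex
  apply Real.pow_arith_mean_le_arith_mean_pow
  · intro i _; positivity
  · rw [Finset.sum_const, nsmul_eq_mul, mul_inv_cancel₀ (card_ne hN)]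
  · intro i _; exact hh _

/-- filter of large `N` with nonempty `S_N` -/
def FF (A : Set ℕ) : Filter ℕ := atTop ⊓ 𝓟 {N : ℕ | 0 < cc A N}

theorem FF_pos (A : Set ℕ) : ∀ᶠ N in FF A, 0 < cc A N :=
  mem_inf_of_right (mem_principal_self _)

theorem FF_le (A : Set ℕ) : FF A ≤ atTop := inf_le_left

theorem FF_ge (A : Set ℕ) (m : ℕ) : ∀ᶠ N in FF A, m ≤ N := FF_le A (eventually_ge_atTop m)

theorem le_fall (j k x : ℕ) : (x - k * j) ^ k ≤ fall j k x := by
  unfold fall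
  calc (x - k * j) ^ k = ∏ i ∈ Finset.range k, (x - k * j) := by simp
    _ ≤ _ := by
      refine Finset.prod_le_prod' fun i hi => ?_
      have : i * j ≤ k * j := Nat.mul_le_mul_right _ (by simpa using Finset.mem_range_le hi)
      omega

theorem fall_le (j k x : ℕ) : fall j k x ≤ x ^ k := by
  unfold fall
  calc _ ≤ ∏ i ∈ Finset.range k, x := Finset.prod_le_prod' fun i hi => by omega
    _ = _ := by simp

theorem Ex_fall {A : Set ℕ} {j : ℕ} (hj : 0 < j) (hjA : j ∈ A) (k N : ℕ) (h : j * k ≤ N) :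
    Ex A j N (fun x => (fall j k x : ℝ)) = cc A (N - j * k) / cc A N := by
  rw [Ex_eq, mm_fall A j hj hjA, if_pos h]

theorem Ex_id {A : Set ℕ} {j : ℕ} (hj : 0 < j) (hjA : j ∈ A) (N : ℕ) (h : j ≤ N) :
    Ex A j N (fun x => (x : ℝ)) = cc A (N - j) / cc A N := by
  rw [Ex_eq, mm_id A j hj hjA, if_pos h]

theorem small_ratio {A : Set ℕ} {d j : ℕ} (hdA : d ∈ A) (hj : 0 < j) (hjA : j ∈ A) (hjd : j < d) :
    Tendsto (fun N : ℕ => Ex A j N (fun x => (x : ℝ)) / N) (FF A) (𝓝 0) := by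
  have hd : 0 < d := by omega
  have hup : ∀ᶠ N in FF A, Ex A j N (fun x => (x : ℝ)) / N ≤
      ((d * j : ℕ) : ℝ) / N + ((1 : ℝ) / N) ^ ((d : ℝ)⁻¹) := by
    filter_upwards [FF_pos A, FF_ge A (j * d), FF_ge A 1] with N hN h1 h2
    have hNr : (0 : ℝ) < N := by exact_mod_cast h2
    set t := Ex A j N (fun x => ((x - d * j : ℕ) : ℝ)) with ht
    have ht0 : 0 ≤ t := by
      have := Ex_mono A j N (h := fun _ => 0) (h' := fun x => ((x - d * j : ℕ) : ℝ))
        (fun x _ => by positivity)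
      rwa [Ex_const hN] at this
    have hpow : t ^ d ≤ (N : ℝ) ^ (d - 1) := by
      calc t ^ d ≤ Ex A j N (fun x => ((x - d * j : ℕ) : ℝ) ^ d) :=
            Ex_pow hN _ (fun x => by positivity) d
        _ ≤ Ex A j N (fun x => (fall j d x : ℝ)) := Ex_mono _ _ _ fun x _ => by
            exact_mod_cast le_fall j d x
        _ = Ex A d N (fun x => (fall d j x : ℝ)) := by
            rw [Ex_fall hj hjA _ _ h1, Ex_fall hd hdA _ _ (by rwa [mul_comm]), mul_comm]
        _ ≤ Ex A d N (fun _ => (N : ℝ) ^ j) := Ex_mono _ _ _ fun x hx => by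
            exact_mod_cast (fall_le d j x).trans (Nat.pow_le_pow_left hx j)
        _ = (N : ℝ) ^ j := Ex_const hN _
        _ ≤ _ := pow_le_pow_right₀ (by exact_mod_cast h2) (by omega)
    have hpow2 : (t / N) ^ d ≤ 1 / N := by
      rw [div_pow, div_le_div_iff₀ (by positivity) hNr, one_mul]
      calc t ^ d * N ≤ (N : ℝ) ^ (d - 1) * N := by gcongr
        _ = N ^ d := by rw [← pow_succ]; congr 1; omega
    have h3 : t / N ≤ ((1 : ℝ) / N) ^ ((d : ℝ)⁻¹) := by
      rw [← Real.pow_rpow_inv_natCast (show 0 ≤ t / N by positivity) hd.ne']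
      exact Real.rpow_le_rpow (by positivity) hpow2 (by positivity)
    have h4 : Ex A j N (fun x => (x : ℝ)) ≤ ((d * j : ℕ) : ℝ) + t := by
      rw [ht, ← Ex_const (j := j) hN (((d * j : ℕ) : ℝ)), ← Ex_add]
      refine Ex_mono _ _ _ fun x _ => ?_
      have : x ≤ d * j + (x - d * j) := by omega
      exact_mod_cast this
    calc _ ≤ (((d * j : ℕ) : ℝ) + t) / N := by gcongr
      _ ≤ _ := by rw [add_div]; gcongr
  have hlo : ∀ᶠ N in FF A, 0 ≤ Ex A j N (fun x => (x : ℝ)) / N := by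
    filter_upwards [FF_pos A] with N hN
    have := Ex_mono A j N (h := fun _ => 0) (h' := fun x => (x : ℝ)) (fun x _ => by positivity)
    rw [Ex_const hN] at this
    positivity
  refine tendsto_of_tendsto_of_tendsto_of_le_of_le' tendsto_const_nhds ?_ hlo hup
  refine Tendsto.mono_left ?_ (FF_le A)
  have e1 : Tendsto (fun N : ℕ => ((d * j : ℕ) : ℝ) / N) atTop (𝓝 0) :=
    tendsto_const_div_atTop_nhds_zero_nat _
  have e2 : Tendsto (fun N : ℕ => ((1 : ℝ) / N) ^ ((d : ℝ)⁻¹)) atTop (𝓝 0) := by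
    have := (tendsto_const_div_atTop_nhds_zero_nat (1 : ℝ)).rpow_const (p := (d : ℝ)⁻¹)
      (Or.inr (by positivity))
    rwa [Real.zero_rpow (by positivity)] at this
  simpa using e1.add e2

theorem top_ratio {A : Set ℕ} (hfin : A.Finite) (hpos : ∀ a ∈ A, 0 < a) {d : ℕ} (hdA : d ∈ A)
    (hd : ∀ a ∈ A, a ≤ d) :
    Tendsto (fun N : ℕ => Ex A d N (fun x => (x : ℝ)) / N) (FF A) (𝓝 1) := by
  classical
  have key : ∀ᶠ N in FF A, 1 - ∑ j ∈ hfin.toFinset.erase d, Ex A j N (fun x => (x : ℝ)) / N =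
      Ex A d N (fun x => (x : ℝ)) / N := by
    filter_upwards [FF_pos A, FF_ge A d, FF_ge A 1] with N hN h1 h2
    have hNr : (0 : ℝ) < N := by exact_mod_cast h2
    have hs : ∑ j ∈ hfin.toFinset, Ex A j N (fun x => (x : ℝ)) = N := by
      have := sum_mm A N
      rw [← div_eq_iff hN.ne', Finset.sum_div] at this
      rw [← this]
      simp_rw [Ex_eq]
      apply Finset.sum_subset
      · intro j hj
        rw [Set.Finite.mem_toFinset] at hj
        exact Finset.mem_Icc.2 ⟨hpos j hj, (hd j hj).trans h1⟩
      · intro j _ hj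
        rw [Set.Finite.mem_toFinset] at hj
        rw [mm_id_zero A j hj, zero_div]
    rw [← Finset.add_sum_erase _ _ ((Set.Finite.mem_toFinset hfin).2 hdA)] at hs
    rw [← Finset.sum_div]
    field_simp
    linarith
  refine Tendsto.congr' key ?_
  have : Tendsto (fun N : ℕ => ∑ j ∈ hfin.toFinset.erase d, Ex A j N (fun x => (x : ℝ)) / N)
      (FF A) (𝓝 (∑ j ∈ hfin.toFinset.erase d, 0)) := by
    refine tendsto_finsetSum _ fun j hj => ?_
    rw [Finset.mem_erase, Set.Finite.mem_toFinset] at hj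
    exact small_ratio hdA (hpos j hj.2) hj.2 (lt_of_le_of_ne (hd j hj.2) hj.1)
  simpa using this.const_sub 1

/-- ratio sequences; shifting -/
theorem shift_tendsto {A : Set ℕ} {k : ℕ} (h : ∀ᶠ N in FF A, 0 < cc A (N - k)) :
    Tendsto (fun N => N - k) (FF A) (FF A) := by
  refine tendsto_inf.2 ⟨(tendsto_sub_atTop_nat k).mono_left (FF_le A), ?_⟩
  exact tendsto_principal.2 h

theorem pos_of_ratio {A : Set ℕ} {k : ℕ} {g : ℕ → ℝ}
    (h : Tendsto (fun N : ℕ => cc A (N - k) / cc A N / g N) (FF A) (𝓝 1)) :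
    ∀ᶠ N in FF A, 0 < cc A (N - k) := by
  filter_upwards [h.eventually (lt_mem_nhds (show (0 : ℝ) < 1 by norm_num))] with N hN
  rcases (cc_nonneg A (N - k)).lt_or_eq with h | h
  · exact h
  · rw [← h] at hN; simp at hN

theorem sub_div_tendsto (k : ℕ) : Tendsto (fun N : ℕ => ((N - k : ℕ) : ℝ) / N) atTop (𝓝 1) := by
  have : Tendsto (fun N : ℕ => 1 - (k : ℝ) / N) atTop (𝓝 (1 - 0)) :=
    (tendsto_const_div_atTop_nhds_zero_nat (k : ℝ)).const_sub 1
  rw [sub_zero] at this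
  refine this.congr' ?_
  filter_upwards [eventually_ge_atTop k, eventually_ge_atTop 1] with N h1 h2
  have hNr : (N : ℝ) ≠ 0 := by positivity
  rw [Nat.cast_sub h1]; field_simp

/-- composing ratio asymptotics with real exponents -/
theorem ratio_add {A : Set ℕ} {k l : ℕ} {p q : ℝ}
    (hk : Tendsto (fun N : ℕ => cc A (N - k) / cc A N / (N : ℝ) ^ p) (FF A) (𝓝 1))
    (hl : Tendsto (fun N : ℕ => cc A (N - l) / cc A N / (N : ℝ) ^ q) (FF A) (𝓝 1)) :
    Tendsto (fun N : ℕ => cc A (N - (k + l)) / cc A N / (N : ℝ) ^ (p + q)) (FF A) (𝓝 1) := by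
  have hpos := pos_of_ratio hk
  have h1 := hl.comp (shift_tendsto hpos)
  have h2 : Tendsto (fun N : ℕ => (((N - k : ℕ) : ℝ) / N) ^ q) (FF A) (𝓝 1) := by
    have := ((sub_div_tendsto k).mono_left (FF_le A)).rpow_const (p := q) (Or.inl one_ne_zero)
    simpa using this
  have h3 := (h1.mul h2).mul hk
  rw [mul_one, mul_one] at h3
  refine h3.congr' ?_
  filter_upwards [hpos, FF_pos A, FF_ge A (k + 1)] with N hN hN0 hge
  have a1 : (0 : ℝ) < ((N - k : ℕ) : ℝ) := by
    have : 0 < N - k := by omega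
    exact_mod_cast this
  have a2 : (0 : ℝ) < N := by
    have : 0 < N := by omega
    exact_mod_cast this
  simp only [Function.comp]
  rw [Real.div_rpow a1.le a2.le, Real.rpow_add a2, Nat.sub_sub]
  have b1 := Real.rpow_pos_of_pos a1 q
  have b2 := Real.rpow_pos_of_pos a2 q
  have b3 := Real.rpow_pos_of_pos a2 p
  field_simp

theorem ratio_zero (A : Set ℕ) :
    Tendsto (fun N : ℕ => cc A (N - 0) / cc A N / (N : ℝ) ^ (0 : ℝ)) (FF A) (𝓝 1) := by
  refine tendsto_const_nhds.congr' ?_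
  filter_upwards [FF_pos A] with N hN
  simp [hN.ne']

theorem top_ratio_mul {A : Set ℕ} (hfin : A.Finite) (hpos : ∀ a ∈ A, 0 < a) {d : ℕ} (hdA : d ∈ A)
    (hd : ∀ a ∈ A, a ≤ d) (k : ℕ) :
    Tendsto (fun N : ℕ => cc A (N - k * d) / cc A N / (N : ℝ) ^ (k : ℝ)) (FF A) (𝓝 1) := by
  have h1 : Tendsto (fun N : ℕ => cc A (N - d) / cc A N / (N : ℝ) ^ (1 : ℝ)) (FF A) (𝓝 1) := by
    refine (top_ratio hfin hpos hdA hd).congr' ?_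
    filter_upwards [FF_ge A d] with N hN
    rw [Ex_id (hpos d hdA) hdA N hN, Real.rpow_one]
  induction k with
  | zero => simpa using ratio_zero A
  | succ k ih =>
    have := ratio_add ih h1
    refine this.congr fun N => ?_
    rw [add_mul, one_mul]; push_cast; rfl

theorem pow_ineq (d : ℕ) {v δ : ℝ} (hv : 0 ≤ v) (hδ : 0 ≤ δ) (hδ1 : δ ≤ 1) :
    (v + δ) ^ d ≤ v ^ d + δ * 2 ^ d * (1 + v ^ (2 * d)) := by
  have h1 : ∀ i ≤ d, v ^ i ≤ 1 + v ^ (2 * d) := by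
    intro i hi
    rcases le_total v 1 with h | h
    · have := pow_le_one₀ (n := i) hv h
      have : 0 ≤ v ^ (2 * d) := by positivity
      linarith
    · have := pow_le_pow_right₀ h (show i ≤ 2 * d by omega)
      linarith
  rw [add_pow, Finset.sum_range_succ]
  simp only [Nat.sub_self, pow_zero, mul_one, Nat.choose_self, Nat.cast_one]
  rw [add_comm]
  gcongr
  calc ∑ i ∈ Finset.range d, v ^ i * δ ^ (d - i) * (d.choose i)
      ≤ ∑ i ∈ Finset.range d, δ * (1 + v ^ (2 * d)) * (d.choose i) := by
        refine Finset.sum_le_sum fun i hi => ?_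
        have hi : i < d := by simpa using hi
        have e1 : δ ^ (d - i) ≤ δ := by
          calc δ ^ (d - i) ≤ δ ^ 1 := pow_le_pow_of_le_one hδ hδ1 (by omega)
            _ = δ := pow_one δ
        have e2 := h1 i hi.le
        have e3 : v ^ i * δ ^ (d - i) ≤ (1 + v ^ (2 * d)) * δ := by
          apply mul_le_mul e2 e1 (by positivity) (by positivity)
        have : (0 : ℝ) ≤ d.choose i := by positivity
        nlinarith
    _ = δ * (1 + v ^ (2 * d)) * ∑ i ∈ Finset.range d, (d.choose i : ℝ) := by rw [Finset.mul_sum]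
    _ ≤ δ * (1 + v ^ (2 * d)) * 2 ^ d := by
        apply mul_le_mul_of_nonneg_left _ (by positivity)
        have := Nat.sum_range_choose d
        have h2 : ∑ i ∈ Finset.range (d + 1), (d.choose i : ℝ) = 2 ^ d := by exact_mod_cast this
        rw [← h2, Finset.sum_range_succ]
        have : (0 : ℝ) ≤ d.choose d := by positivity
        linarith
    _ = _ := by ring

theorem sq_ineq (d : ℕ) (hd : 0 < d) {v : ℝ} (hv : 0 ≤ v) :
    (v - 1) ^ 2 ≤ v ^ (2 * d) - 2 * v ^ d + 1 := by
  have e : v ^ (2 * d) - 2 * v ^ d + 1 = (v ^ d - 1) ^ 2 := by ring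
  rw [e]
  apply sq_le_sq.2
  rcases le_total v 1 with h | h
  · have := pow_le_of_le_one hv h hd.ne'
    rw [abs_of_nonpos (by linarith), abs_of_nonpos (by linarith)]
    linarith
  · have := le_self_pow₀ h hd.ne'
    rw [abs_of_nonneg (by linarith), abs_of_nonneg (by linarith)]
    linarith

theorem fin_ratio {A : Set ℕ} (hfin : A.Finite) (hpos : ∀ a ∈ A, 0 < a) {d : ℕ} (hdA : d ∈ A)
    (hd : ∀ a ∈ A, a ≤ d) {j : ℕ} (hjA : j ∈ A) :
    Tendsto (fun N : ℕ => cc A (N - j) / cc A N / (N : ℝ) ^ ((j : ℝ) * (d : ℝ)⁻¹))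
      (FF A) (𝓝 1) := by
  have hd0 := hpos d hdA
  have hj0 := hpos j hjA
  set α : ℕ → ℝ := fun N => cc A (N - j * d) / cc A N / (N : ℝ) ^ (j : ℝ) with hα
  set β : ℕ → ℝ := fun N => cc A (N - (2 * j) * d) / cc A N / (N : ℝ) ^ ((2 * j : ℕ) : ℝ) with hβ
  have hαt : Tendsto α (FF A) (𝓝 1) := top_ratio_mul hfin hpos hdA hd j
  have hβt : Tendsto β (FF A) (𝓝 1) := top_ratio_mul hfin hpos hdA hd (2 * j)
  set δ : ℕ → ℝ := fun N => ((2 * d * j : ℕ) : ℝ) / (N : ℝ) ^ ((j : ℝ) * (d : ℝ)⁻¹) with hδ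
  have hδt : Tendsto δ (FF A) (𝓝 0) := by
    apply Tendsto.mono_left _ (FF_le A)
    apply Tendsto.div_atTop tendsto_const_nhds
    exact (tendsto_rpow_atTop (by positivity)).comp tendsto_natCast_atTop_atTop
  set γ : ℕ → ℝ := fun N => β N - 2 * (α N - δ N * 2 ^ d * (1 + β N)) + 1 with hγ
  have hγt : Tendsto γ (FF A) (𝓝 0) := by
    have := (hβt.sub ((hαt.sub ((hδt.mul_const (2 ^ d)).mul (hβt.const_add 1))).const_mul 2)).add_const 1
    convert this using 2
    ring
  have hst : Tendsto (fun N => √(γ N) + δ N) (FF A) (𝓝 0) := by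
    have := hγt.sqrt.add hδt
    simpa using this
  rw [tendsto_iff_dist_tendsto_zero]
  refine squeeze_zero' (Eventually.of_forall fun _ => dist_nonneg) ?_ hst
  filter_upwards [FF_pos A, FF_ge A 1, FF_ge A (j * (2 * d)),
    hδt.eventually (gt_mem_nhds (show (0 : ℝ) < 1 by norm_num))] with N hN hN1 hN2 hδ1
  have hNr : (0 : ℝ) < N := by exact_mod_cast hN1
  set n : ℝ := (N : ℝ) ^ ((j : ℝ) * (d : ℝ)⁻¹) with hn
  have hn0 : 0 < n := Real.rpow_pos_of_pos hNr _
  have hnd : n ^ d = (N : ℝ) ^ j := by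
    rw [hn, ← Real.rpow_natCast, ← Real.rpow_mul hNr.le, mul_assoc, inv_mul_cancel₀ (by positivity),
      mul_one, Real.rpow_natCast]
  have hnd2 : n ^ (2 * d) = (N : ℝ) ^ (2 * j) := by
    rw [mul_comm 2 d, pow_mul, hnd, ← pow_mul, mul_comm]
  have hδ0 : 0 ≤ δ N := by simp only [hδ]; positivity
  set v : ℕ → ℝ := fun x => ((x - 2 * d * j : ℕ) : ℝ) / n with hv
  have hv0 : ∀ x, 0 ≤ v x := fun x => by simp only [hv]; positivity
  have hvx : ∀ x : ℕ, (x : ℝ) / n ≤ v x + δ N := by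
    intro x
    simp only [hv, hδ]
    rw [← add_div]
    gcongr
    have : x ≤ x - 2 * d * j + 2 * d * j := by omega
    exact_mod_cast this
  have hEβ : Ex A j N (fun x => v x ^ (2 * d)) ≤ β N := by
    calc _ ≤ Ex A j N (fun x => (n ^ (2 * d))⁻¹ * (fall j (2 * d) x : ℝ)) := by
          refine Ex_mono _ _ _ fun x _ => ?_
          simp only [hv]
          rw [div_pow, div_eq_inv_mul]
          gcongr
          exact_mod_cast le_fall j (2 * d) x
      _ = β N := by
          rw [Ex_smul, Ex_fall hj0 hjA _ _ hN2, hnd2]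
          simp only [hβ]
          rw [Real.rpow_natCast, ← mul_assoc, mul_comm 2 j, mul_assoc j 2 d]
          field_simp
  have hEα : α N ≤ Ex A j N (fun x => v x ^ d) + δ N * 2 ^ d * (1 + Ex A j N (fun x => v x ^ (2 * d))) := by
    calc α N = Ex A j N (fun x => (n ^ d)⁻¹ * (fall j d x : ℝ)) := by
          rw [Ex_smul, Ex_fall hj0 hjA _ _ (by nlinarith), hnd]
          simp only [hα]
          rw [Real.rpow_natCast]
          field_simp
      _ ≤ Ex A j N (fun x => v x ^ d + δ N * 2 ^ d * (1 + v x ^ (2 * d))) := by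
          refine Ex_mono _ _ _ fun x _ => ?_
          refine le_trans ?_ (pow_ineq d (hv0 x) hδ0 hδ1.le)
          calc (n ^ d)⁻¹ * (fall j d x : ℝ) ≤ (n ^ d)⁻¹ * (x : ℝ) ^ d := by
                gcongr; exact_mod_cast fall_le j d x
            _ = ((x : ℝ) / n) ^ d := by rw [div_pow]; field_simp
            _ ≤ _ := by gcongr; exact hvx x
      _ = _ := by
          rw [Ex_add A j N (fun x => v x ^ d), Ex_smul A j N _ (fun x => 1 + v x ^ (2 * d)),
            Ex_add A j N (fun _ => 1), Ex_const hN]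
  set e := Ex A j N v with he
  have hsq : (e - 1) ^ 2 ≤ γ N := by
    have e1 : (e - 1) ^ 2 ≤ Ex A j N (fun x => (v x - 1) ^ 2) := by
      have e2 : 0 ≤ Ex A j N (fun x => (v x - e) ^ 2) := by
        have := Ex_mono A j N (h := fun _ => 0) (h' := fun x => (v x - e) ^ 2)
          (fun x _ => by positivity)
        rwa [Ex_const hN] at this
      have e3 : Ex A j N (fun x => (v x - 1) ^ 2) = Ex A j N (fun x => (v x - e) ^ 2) + (e - 1) ^ 2 := by
        have : (fun x => (v x - 1) ^ 2) = fun x => ((v x - e) ^ 2 + (2 * (e - 1)) * v x) + (1 - e ^ 2) := by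
          funext x; ring
        rw [this, Ex_add A j N (fun x => (v x - e) ^ 2 + (2 * (e - 1)) * v x) (fun _ => 1 - e ^ 2),
          Ex_add A j N (fun x => (v x - e) ^ 2), Ex_smul, Ex_const hN, ← he]
        ring
      linarith
    have e4 : Ex A j N (fun x => (v x - 1) ^ 2) ≤
        Ex A j N (fun x => v x ^ (2 * d)) - 2 * Ex A j N (fun x => v x ^ d) + 1 := by
      calc _ ≤ Ex A j N (fun x => (v x ^ (2 * d) + (-2) * v x ^ d) + 1) :=
            Ex_mono _ _ _ fun x _ => by
              have := sq_ineq d hd0 (hv0 x)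
              linarith
        _ = _ := by
            rw [Ex_add A j N (fun x => v x ^ (2 * d) + (-2) * v x ^ d) (fun _ => 1),
              Ex_add A j N (fun x => v x ^ (2 * d)), Ex_smul A j N (-2) (fun x => v x ^ d), Ex_const hN]
            ring
    have e5 : δ N * 2 ^ d * (1 + Ex A j N (fun x => v x ^ (2 * d))) ≤ δ N * 2 ^ d * (1 + β N) := by
      gcongr
    simp only [hγ]
    linarith
  have habs : |e - 1| ≤ √(γ N) := Real.abs_le_sqrt hsq
  have hX : cc A (N - j) / cc A N / n = Ex A j N (fun x => (x : ℝ) / n) := by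
    have : (fun x : ℕ => (x : ℝ) / n) = fun x : ℕ => n⁻¹ * (x : ℝ) := by funext x; field_simp
    rw [this, Ex_smul A j N _ (fun x => (x : ℝ)), Ex_id hj0 hjA N (by nlinarith)]
    field_simp
  have hlo : e ≤ cc A (N - j) / cc A N / n := by
    rw [hX]
    refine Ex_mono _ _ _ fun x _ => ?_
    simp only [hv]
    gcongr
    omega
  have hhi : cc A (N - j) / cc A N / n ≤ e + δ N := by
    rw [hX, ← Ex_const (j := j) hN (δ N), he, ← Ex_add]
    exact Ex_mono _ _ _ fun x _ => hvx x
  rw [Real.dist_eq]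
  rw [abs_le] at habs ⊢
  constructor <;> linarith [habs.1, habs.2]

theorem inf_ratio {A : Set ℕ} {l : ℝ} (hl : 0 < l) (h : Tendsto (cc A) atTop (𝓝 l)) (j : ℕ) :
    Tendsto (fun N : ℕ => cc A (N - j) / cc A N / (N : ℝ) ^ (0 : ℝ)) (FF A) (𝓝 1) := by
  apply Tendsto.mono_left _ (FF_le A)
  have := (h.comp (tendsto_sub_atTop_nat j)).div h hl.ne'
  rw [div_self hl.ne'] at this
  refine this.congr fun N => ?_
  simp

end PG

open Filter Topology
namespace PG
open Function

theorem fin_max {A : Set ℕ} (hne : A.Nonempty) (hfin : A.Finite) {d : ℕ∞}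
    (hd : (∀ a ∈ A, (a : ℕ∞) ≤ d) ∧ ∀ e : ℕ∞, (∀ a ∈ A, (a : ℕ∞) ≤ e) → d ≤ e) :
    ∃ m ∈ A, d = (m : ℕ∞) ∧ ∀ a ∈ A, a ≤ m := by
  obtain ⟨m, hm, hmax⟩ := Set.exists_max_image A id hfin hne
  refine ⟨m, hm, le_antisymm ?_ (hd.1 m hm), hmax⟩
  exact hd.2 _ fun a ha => by exact_mod_cast hmax a ha

theorem inf_top {A : Set ℕ} (hinf : ¬ A.Finite) {d : ℕ∞}
    (hd : (∀ a ∈ A, (a : ℕ∞) ≤ d) ∧ ∀ e : ℕ∞, (∀ a ∈ A, (a : ℕ∞) ≤ e) → d ≤ e) : d = ⊤ := by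
  induction d using ENat.recTopCoe with
  | top => rfl
  | coe n =>
    exfalso; apply hinf
    refine (Set.finite_Iic n).subset fun a ha => ?_
    have := hd.1 a ha
    exact_mod_cast this

theorem ratio_mem {A : Set ℕ} (hne : A.Nonempty) (hpos : ∀ a ∈ A, 0 < a)
    (hcond : A.Finite ∨ Summable ((Aᶜ : Set ℕ).indicator fun j => (1 : ℝ) / j))
    {d : ℕ∞}
    (hd : (∀ a ∈ A, (a : ℕ∞) ≤ d) ∧ ∀ e : ℕ∞, (∀ a ∈ A, (a : ℕ∞) ≤ e) → d ≤ e)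
    {j : ℕ} (hj : j ∈ A) :
    Tendsto (fun N : ℕ => cc A (N - j) / cc A N / (N : ℝ) ^ ((j : ℝ) * (d.toNat : ℝ)⁻¹))
      (FF A) (𝓝 1) := by
  by_cases hfin : A.Finite
  · obtain ⟨m, hm, rfl, hmax⟩ := fin_max hne hfin hd
    simpa using fin_ratio hfin hpos hm hmax hj
  · obtain ⟨l, hl, ht⟩ := inf_case A (hcond.resolve_left hfin)
    rw [inf_top hfin hd]
    simpa using inf_ratio hl ht j

theorem ratio_closure {A : Set ℕ} (hne : A.Nonempty) (hpos : ∀ a ∈ A, 0 < a)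
    (hcond : A.Finite ∨ Summable ((Aᶜ : Set ℕ).indicator fun j => (1 : ℝ) / j))
    {d : ℕ∞}
    (hd : (∀ a ∈ A, (a : ℕ∞) ≤ d) ∧ ∀ e : ℕ∞, (∀ a ∈ A, (a : ℕ∞) ≤ e) → d ≤ e)
    {k : ℕ} (hk : k ∈ AddSubmonoid.closure A) :
    Tendsto (fun N : ℕ => cc A (N - k) / cc A N / (N : ℝ) ^ ((k : ℝ) * (d.toNat : ℝ)⁻¹))
      (FF A) (𝓝 1) := by
  induction hk using AddSubmonoid.closure_induction with
  | mem j hj => exact ratio_mem hne hpos hcond hd hj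
  | zero => simpa using ratio_zero A
  | add x y _ _ hx hy =>
    have := ratio_add hx hy
    refine this.congr fun N => ?_
    push_cast
    rw [add_mul]

theorem small_mem {A : Set ℕ} (hne : A.Nonempty) (hpos : ∀ a ∈ A, 0 < a)
    (hcond : A.Finite ∨ Summable ((Aᶜ : Set ℕ).indicator fun j => (1 : ℝ) / j))
    {d : ℕ∞}
    (hd : (∀ a ∈ A, (a : ℕ∞) ≤ d) ∧ ∀ e : ℕ∞, (∀ a ∈ A, (a : ℕ∞) ≤ e) → d ≤ e)
    {j : ℕ} (hjd : (j : ℕ∞) < d) :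
    Tendsto (fun N : ℕ => Ex A j N (fun x => (x : ℝ)) / N) (FF A) (𝓝 0) := by
  by_cases hj : j ∈ A
  swap
  · refine tendsto_const_nhds.congr fun N => ?_
    rw [Ex_eq, mm_id_zero A j hj]; simp
  by_cases hfin : A.Finite
  · obtain ⟨m, hm, rfl, hmax⟩ := fin_max hne hfin hd
    exact small_ratio hm (hpos j hj) hj (by exact_mod_cast hjd)
  · obtain ⟨l, hl, ht⟩ := inf_case A (hcond.resolve_left hfin)
    have h1 := inf_ratio hl ht j
    simp only [Real.rpow_zero, div_one] at h1
    have h2 : Tendsto (fun N : ℕ => ((N : ℝ))⁻¹) (FF A) (𝓝 0) :=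
      tendsto_inv_atTop_nhds_zero_nat.mono_left (FF_le A)
    have := h1.mul h2
    rw [mul_zero] at this
    refine this.congr' ?_
    filter_upwards [FF_ge A j] with N hN
    rw [Ex_id (hpos j hj) hj N hN, div_eq_mul_inv _ (N : ℝ)]

end PG

open Filter Topology
namespace PG
open Function

section rel
variable {W : Type} (E : W → W → Prop)

/-- `n`-step reachability -/
def St : ℕ → W → W → Prop
  | 0, a, b => a = b
  | n + 1, a, b => ∃ c, St n a c ∧ E c b

/-- vertices lying on a directed cycle -/
def inL (w : W) : Prop := ∃ n, 0 < n ∧ St E n w w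

/-- vertices without incoming edge -/
def isRoot (r : W) : Prop := ∀ a, ¬ E a r

variable {E}

theorem St_add {m n : ℕ} {a b c : W} (h1 : St E m a b) (h2 : St E n b c) : St E (m + n) a c := by
  induction n generalizing c with
  | zero => cases h2; exact h1
  | succ n ih => obtain ⟨x, hx, hxc⟩ := h2; exact ⟨x, ih hx, hxc⟩

theorem St_split {m n : ℕ} {a c : W} (h : St E (m + n) a c) : ∃ b, St E m a b ∧ St E n b c := by
  induction n generalizing c with
  | zero => exact ⟨c, h, rfl⟩
  | succ n ih =>
    obtain ⟨x, hx, hxc⟩ := h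
    obtain ⟨b, h1, h2⟩ := ih hx
    exact ⟨b, h1, x, h2, hxc⟩

theorem St_one {a b : W} : St E 1 a b ↔ E a b :=
  ⟨fun ⟨c, h, h'⟩ => by cases h; exact h', fun h => ⟨a, rfl, h⟩⟩

theorem St_fun (hf : ∀ a b b', E a b → E a b' → b = b') {n : ℕ} {a b b' : W}
    (h : St E n a b) (h' : St E n a b') : b = b' := by
  induction n generalizing b b' with
  | zero => cases h; cases h'; rfl
  | succ n ih =>
    obtain ⟨x, hx, hxc⟩ := h
    obtain ⟨y, hy, hyc⟩ := h'
    cases ih hx hy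
    exact hf _ _ _ hxc hyc

theorem St_inj (hi : ∀ a a' b, E a b → E a' b → a = a') {n : ℕ} {a a' b : W}
    (h : St E n a b) (h' : St E n a' b) : a = a' := by
  induction n generalizing b with
  | zero => cases h; cases h'; rfl
  | succ n ih =>
    obtain ⟨x, hx, hxc⟩ := h
    obtain ⟨y, hy, hyc⟩ := h'
    cases hi _ _ _ hxc hyc
    exact ih hx hy

theorem root_St {k : ℕ} {a r : W} (hr : isRoot E r) (h : St E k a r) : k = 0 ∧ a = r := by
  rcases k with _ | k
  · exact ⟨rfl, h⟩
  · obtain ⟨x, _, hx⟩ := h; exact absurd hx (hr x)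

theorem root_unique (hi : ∀ a a' b, E a b → E a' b → a = a') {n n' : ℕ} {r r' v : W}
    (hr : isRoot E r) (hr' : isRoot E r') (h : St E n r v) (h' : St E n' r' v) :
    n = n' ∧ r = r' := by
  rcases le_total n n' with hle | hle
  · obtain ⟨k, rfl⟩ := Nat.exists_eq_add_of_le' hle
    obtain ⟨b, h1, h2⟩ := St_split h'
    cases St_inj hi h h2
    obtain ⟨rfl, rfl⟩ := root_St hr h1
    simp
  · obtain ⟨k, rfl⟩ := Nat.exists_eq_add_of_le' hle
    obtain ⟨b, h1, h2⟩ := St_split h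
    cases St_inj hi h' h2
    obtain ⟨rfl, rfl⟩ := root_St hr' h1
    simp

theorem not_inL_of_root (hi : ∀ a a' b, E a b → E a' b → a = a') {n : ℕ} {r v : W}
    (hr : isRoot E r) (h : St E n r v) : ¬ inL E v := by
  rintro ⟨m, hm, hv⟩
  have hmul : ∀ j, St E (j * m) v v := by
    intro j
    induction j with
    | zero => rw [zero_mul]; exact rfl
    | succ j ih => rw [add_mul, one_mul]; exact St_add ih hv
  have h2 := hmul (n + 1)
  obtain ⟨k, hk⟩ := Nat.exists_eq_add_of_le' (show n ≤ (n + 1) * m by nlinarith)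
  rw [hk] at h2
  obtain ⟨b, h3, h4⟩ := St_split h2
  cases St_inj hi h h4
  have := (root_St hr h3).1
  subst this
  nlinarith

theorem inL_or_root [Finite W] (hf : ∀ a b b', E a b → E a b' → b = b') (v : W) :
    inL E v ∨ ∃ r n, isRoot E r ∧ St E n r v := by
  classical
  by_cases hall : ∀ n, ∃ a, St E n a v
  · left
    choose a ha using hall
    obtain ⟨n, m, hnm, heq⟩ := Finite.exists_ne_map_eq_of_infinite a
    have key : ∀ n m, n < m → a n = a m → inL E v := by
      intro n m hlt heq
      obtain ⟨k, rfl⟩ := Nat.exists_eq_add_of_le hlt.le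
      have h1 := ha n
      have h2 := ha (n + k)
      rw [← heq] at h2
      obtain ⟨b, h3, h4⟩ := St_split h2
      cases St_fun hf h1 h3
      exact ⟨k, by omega, h4⟩
    rcases lt_or_gt_of_ne hnm with h | h
    · exact key n m h heq
    · exact key m n h heq.symm
  · right
    push Not at hall
    have hmin : ∀ m, m < Nat.find hall → ¬ ∀ a, ¬ St E m a v := fun m hm => Nat.find_min hall hm
    have hspec := Nat.find_spec hall
    set n := Nat.find hall
    have hn : n ≠ 0 := by
      intro h0; rw [h0] at hspec; exact hspec v rfl
    have := hmin (n - 1) (show n - 1 < n by omega)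
    push Not at this
    obtain ⟨a, ha⟩ := this
    refine ⟨a, n - 1, fun x hx => ?_, ha⟩
    apply hspec x
    have := St_add (St_one.2 hx) ha
    rwa [show 1 + (n - 1) = n by omega] at this

theorem inL_next {w : W} (h : inL E w) : ∃ c, E w c ∧ inL E c := by
  obtain ⟨n, hn, h⟩ := h
  rw [show n = 1 + (n - 1) by omega] at h
  obtain ⟨c, h1, h2⟩ := St_split h
  exact ⟨c, St_one.1 h1, n, hn, by
    have := St_add h2 h1
    rwa [show n - 1 + 1 = n by omega] at this⟩

theorem inL_back (hi : ∀ a a' b, E a b → E a' b → a = a') {a b : W} (hab : E a b)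
    (h : inL E b) : inL E a := by
  obtain ⟨n, hn, h⟩ := h
  rw [show n = (n - 1) + 1 by omega] at h
  obtain ⟨c, h1, h2⟩ := h
  cases hi _ _ _ hab h2
  refine ⟨n, hn, ?_⟩
  have := St_add (St_one.2 hab) h1
  rwa [show 1 + (n - 1) = n by omega] at this

/-- the permutation of loop vertices -/
theorem exists_perm [Finite W] (hf : ∀ a b b', E a b → E a b' → b = b')
    (hi : ∀ a a' b, E a b → E a' b → a = a') :
    ∃ π : Equiv.Perm {w // inL E w}, ∀ l, E l.1 (π l).1 := by
  choose g hg hg' using fun l : {w // inL E w} => inL_next l.2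
  have hinj : Injective (fun l : {w // inL E w} => (⟨g l, hg' l⟩ : {w // inL E w})) := by
    intro a b h
    have h : g a = g b := by simpa using h
    apply Subtype.ext
    apply hi _ _ _ (hg a)
    rw [h]; exact hg b
  exact ⟨Equiv.ofBijective _ (Finite.injective_iff_bijective.1 hinj), fun l => hg l⟩

theorem St_perm (hf : ∀ a b b', E a b → E a b' → b = b') {π : Equiv.Perm {w // inL E w}}
    (hπ : ∀ l, E l.1 (π l).1) (l : {w // inL E w}) (n : ℕ) (b : W) :
    St E n l.1 b ↔ b = (π^[n] l).1 := by
  have h1 : St E n l.1 (π^[n] l).1 := by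
    induction n with
    | zero => exact rfl
    | succ n ih => rw [iterate_succ_apply']; exact ⟨_, ih, hπ _⟩
  exact ⟨fun h => St_fun hf h h1, fun h => h ▸ h1⟩

theorem compat_St {X : Type} {σ : Equiv.Perm X} {f : W → X} (h : ∀ a b, E a b → σ (f a) = f b)
    {n : ℕ} {a b : W} (hs : St E n a b) : f b = σ^[n] (f a) := by
  induction n generalizing b with
  | zero => cases hs; rfl
  | succ n ih =>
    obtain ⟨c, h1, h2⟩ := hs
    rw [iterate_succ_apply', ← ih h1, h _ _ h2]

end rel

open Classical in
theorem card_slice {I X : Type} [Fintype I] [DecidableEq I] [Fintype X] (Z : Finset (I → X)) (r : I) (K : ℕ)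
    (h : ∀ x' : I → X, (Finset.univ.filter fun z => update x' r z ∈ Z).card ≤ K) :
    Fintype.card X * Z.card ≤ K * Fintype.card X ^ Fintype.card I := by
  have h2 : ∑ x' : I → X, (Finset.univ.filter fun z => update x' r z ∈ Z).card
      = Fintype.card X * Z.card := by
    simp_rw [Finset.card_filter]
    have e : ∀ x' : I → X, ∑ z : X, (if update x' r z ∈ Z then 1 else 0)
      = ∑ y ∈ Z, if update x' r (y r) = y then 1 else 0 := by
      intro x'
      rw [← Finset.sum_filter, ← Finset.sum_filter]
      simp only [Finset.sum_const, smul_eq_mul, mul_one]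
      refine Finset.card_bij' (fun z _ => update x' r z) (fun y _ => y r) ?_ ?_ ?_ ?_
      · intro z hz; simp at hz; simp [hz]
      · intro y hy; simp at hy; simp [hy]
      · intro z hz; simp
      · intro y hy; simp at hy; exact hy.2
    simp_rw [e]
    rw [Finset.sum_comm]
    have e2 : ∀ y ∈ Z, ∑ x' : I → X, (if update x' r (y r) = y then 1 else 0) = Fintype.card X := by
      intro y _
      rw [← Finset.sum_filter]
      simp only [Finset.sum_const, smul_eq_mul, mul_one]
      rw [← Finset.card_univ]
      refine Finset.card_bij' (fun x' _ => x' r) (fun z _ => update y r z) ?_ ?_ ?_ ?_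
      · intro z hz; simp
      · intro y hy; simp
      · intro z hz; simp at hz; rw [← hz]; simp
      · intro y hy; simp
    rw [Finset.sum_congr rfl e2, Finset.sum_const, smul_eq_mul, mul_comm]
  rw [← h2]
  calc _ ≤ ∑ x' : I → X, K := Finset.sum_le_sum fun x' _ => h x'
    _ = _ := by simp [mul_comm]

theorem card_fix {N t : ℕ} (ht : 0 < t) {K : ℕ} (htK : t ≤ K) (σ : Equiv.Perm (Fin N))
    [DecidablePred fun z => σ^[t] z = z] :
    (Finset.univ.filter fun z => σ^[t] z = z).card ≤ ∑ k ∈ Finset.Icc 1 K, Jc k σ := by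
  classical
  unfold Jc
  calc _ ≤ ((Finset.Icc 1 K).biUnion fun k =>
        Finset.univ.filter fun x : Fin N => minimalPeriod σ x = k).card := by
        apply Finset.card_le_card
        intro z hz
        simp only [Finset.mem_filter, Finset.mem_univ, true_and] at hz
        simp only [Finset.mem_biUnion, Finset.mem_filter, Finset.mem_univ, true_and, Finset.mem_Icc]
        refine ⟨_, ⟨minPer_pos σ z, ?_⟩, rfl⟩
        exact (IsPeriodicPt.minimalPeriod_le ht hz).trans htK
    _ ≤ _ := Finset.card_biUnion_le

end PG

open Filter Topology
namespace PG
open Function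

section count
open Classical
variable {W : Type} [Fintype W] {E : W → W → Prop}

/-- number of injective compatible extensions -/
noncomputable def nx (E : W → W → Prop) {N : ℕ} (fL : {w // inL E w} → Fin N) (σ : Equiv.Perm (Fin N)) : ℕ :=
  (Finset.univ.filter fun f : W → Fin N => Injective f ∧ (∀ l : {w // inL E w}, f l.1 = fL l) ∧
    ∀ a b, E a b → σ (f a) = f b).card

theorem nx_bounds (hf : ∀ a b b', E a b → E a b' → b = b')
    (hi : ∀ a a' b, E a b → E a' b → a = a') {π : Equiv.Perm {w // inL E w}}
    (hπ : ∀ l, E l.1 (π l).1) {K : ℕ} (hK : ∀ r n v, isRoot E r → St E n r v → n ≤ K)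
    {N : ℕ} (fL : {w // inL E w} → Fin N) (hfL : Injective fL) (σ : Equiv.Perm (Fin N))
    (hσ : ∀ l, σ (fL l) = fL (π l)) :
    nx E fL σ ≤ N ^ Fintype.card {r // isRoot E r} ∧
    N * N ^ Fintype.card {r // isRoot E r} ≤ N * nx E fL σ +
      Fintype.card W ^ 2 * ((1 + ∑ k ∈ Finset.Icc 1 K, Jc k σ) * N ^ Fintype.card {r // isRoot E r}) := by
  have hch : ∀ v, ¬ inL E v → ∃ r : {r // isRoot E r}, ∃ n, St E n r.1 v := by
    intro v hv
    rcases inL_or_root hf v with h | ⟨r, n, hr, h⟩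
    · exact absurd h hv
    · exact ⟨⟨r, hr⟩, n, h⟩
  choose rt dep hst using hch
  set ex : ({r // isRoot E r} → Fin N) → W → Fin N := fun x v =>
    if h : inL E v then fL ⟨v, h⟩ else σ^[dep v h] (x (rt v h)) with hex
  have exL : ∀ x v (h : inL E v), ex x v = fL ⟨v, h⟩ := fun x v h => by simp [hex, h]
  have exN : ∀ x v (h : ¬ inL E v), ex x v = σ^[dep v h] (x (rt v h)) := fun x v h => by simp [hex, h]
  have exr : ∀ x (r : {r // isRoot E r}), ex x r.1 = x r := by
    intro x r
    have hn : ¬ inL E r.1 := not_inL_of_root hi r.2 (n := 0) rfl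
    rw [exN x r.1 hn]
    obtain ⟨h1, h2⟩ := root_unique hi (rt r.1 hn).2 r.2 (hst r.1 hn) (n' := 0) rfl
    rw [h1, Subtype.ext h2]; rfl
  have exc : ∀ x a b, E a b → σ (ex x a) = ex x b := by
    intro x a b hab
    by_cases ha : inL E a
    · have hb : b = (π ⟨a, ha⟩).1 := hf _ _ _ hab (hπ ⟨a, ha⟩)
      subst hb
      rw [exL x a ha, exL x _ (π ⟨a, ha⟩).2, hσ]
    · have hb : ¬ inL E b := fun hb => ha (inL_back hi hab hb)
      rw [exN x a ha, exN x b hb]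
      have h3 : St E (dep a ha + 1) (rt a ha).1 b := ⟨a, hst a ha, hab⟩
      obtain ⟨h1, h2⟩ := root_unique hi (rt b hb).2 (rt a ha).2 (hst b hb) h3
      rw [h1, Subtype.ext h2, iterate_succ_apply']
  have hn : nx E fL σ = (Finset.univ.filter fun x => Injective (ex x)).card := by
    unfold nx
    symm
    refine Finset.card_bij (fun x _ => ex x) ?_ ?_ ?_
    · intro x hx
      simp only [Finset.mem_filter, Finset.mem_univ, true_and] at hx ⊢
      exact ⟨hx, fun l => exL x l.1 l.2, exc x⟩
    · intro x _ y _ h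
      ext r
      rw [← exr x r, ← exr y r, h]
    · intro f hff
      simp only [Finset.mem_filter, Finset.mem_univ, true_and] at hff ⊢
      obtain ⟨h1, h2, h3⟩ := hff
      have : ex (fun r => f r.1) = f := by
        funext v
        by_cases hv : inL E v
        · rw [exL (fun r => f r.1) v hv, ← h2]
        · rw [exN (fun r => f r.1) v hv, ← compat_St h3 (hst v hv)]
      exact ⟨fun r => f r.1, by rw [this]; exact h1, this⟩
  have htot : (Finset.univ.filter fun x => Injective (ex x)).card +
      (Finset.univ.filter fun x => ¬ Injective (ex x)).card = N ^ Fintype.card {r // isRoot E r} := by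
    rw [Finset.card_filter_add_card_filter_not]; simp
  set J := ∑ k ∈ Finset.Icc 1 K, Jc k σ with hJ
  have hZ1 : ∀ v v', v ≠ v' → ¬ inL E v →
      N * (Finset.univ.filter fun x => ex x v = ex x v').card
        ≤ (1 + J) * N ^ Fintype.card {r // isRoot E r} := by
    intro v v' hvv hv
    have := card_slice (Finset.univ.filter fun x => ex x v = ex x v') (rt v hv) (1 + J) ?_
    · simpa using this
    intro x'
    simp only [Finset.mem_filter, Finset.mem_univ, true_and]
    by_cases hc : ∃ c, ∀ z, ex (update x' (rt v hv) z) v' = c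
    · obtain ⟨c, hc⟩ := hc
      refine le_trans ?_ (Nat.le_add_right 1 J)
      apply Finset.card_le_one.2
      intro a ha b hb
      simp only [Finset.mem_filter, Finset.mem_univ, true_and, hc] at ha hb
      rw [exN _ v hv, update_self] at ha hb
      exact (σ.injective.iterate _) (ha.trans hb.symm)
    · have hv' : ¬ inL E v' := fun h => hc ⟨_, fun z => exL _ _ h⟩
      have hr : rt v' hv' = rt v hv := by
        by_contra hne
        exact hc ⟨_, fun z => by rw [exN _ _ hv', update_of_ne hne]⟩
      have key : ∀ (m n : ℕ), m < n → n ≤ K →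
          (Finset.univ.filter fun z => σ^[n] z = σ^[m] z).card ≤ J := by
        intro m n hmn hnK
        refine le_trans (Finset.card_le_card ?_) (card_fix (t := n - m) (by omega) (by omega) σ)
        intro z hz
        simp only [Finset.mem_filter, Finset.mem_univ, true_and] at hz ⊢
        rw [show n = m + (n - m) by omega, iterate_add_apply] at hz
        exact (σ.injective.iterate _) hz
      refine le_trans ?_ (Nat.le_add_left J 1)
      have e : ∀ z, (ex (update x' (rt v hv) z) v = ex (update x' (rt v hv) z) v') ↔
          σ^[dep v hv] z = σ^[dep v' hv'] z := by
        intro z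
        rw [exN _ _ hv, exN _ _ hv', hr, update_self]
      simp only [e]
      rcases lt_trichotomy (dep v hv) (dep v' hv') with h | h | h
      · have := key _ _ h (hK _ _ _ (rt v' hv').2 (hst v' hv'))
        simpa only [eq_comm] using this
      · exfalso
        have h1 := hst v hv
        have h2 := hst v' hv'
        rw [hr, ← h] at h2
        exact hvv (St_fun hf h1 h2)
      · exact key _ _ h (hK _ _ _ (rt v hv).2 (hst v hv))
  have hZ : ∀ v v', v ≠ v' →
      N * (Finset.univ.filter fun x => ex x v = ex x v').card
        ≤ (1 + J) * N ^ Fintype.card {r // isRoot E r} := by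
    intro v v' hvv
    by_cases hv : inL E v
    · by_cases hv' : inL E v'
      · have : (Finset.univ.filter fun x => ex x v = ex x v') = ∅ := by
          apply Finset.filter_eq_empty_iff.2
          intro x _ h
          rw [exL x v hv, exL x v' hv'] at h
          exact hvv (by simpa using hfL h)
        rw [this]; simp
      · have := hZ1 v' v hvv.symm hv'
        simpa only [eq_comm] using this
    · exact hZ1 v v' hvv hv
  have hbad : N * (Finset.univ.filter fun x => ¬ Injective (ex x)).card ≤
      Fintype.card W ^ 2 * ((1 + J) * N ^ Fintype.card {r // isRoot E r}) := by
    have h1 : (Finset.univ.filter fun x => ¬ Injective (ex x)) ⊆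
        (Finset.univ.filter fun p : W × W => p.1 ≠ p.2).biUnion fun p =>
          Finset.univ.filter fun x => ex x p.1 = ex x p.2 := by
      intro x hx
      simp only [Finset.mem_filter, Finset.mem_univ, true_and, Injective, not_forall] at hx
      obtain ⟨a, b, h1, h2⟩ := hx
      simp only [Finset.mem_biUnion, Finset.mem_filter, Finset.mem_univ, true_and]
      exact ⟨(a, b), h2, h1⟩
    calc _ ≤ N * ∑ p ∈ Finset.univ.filter (fun p : W × W => p.1 ≠ p.2),
          (Finset.univ.filter fun x => ex x p.1 = ex x p.2).card :=
          Nat.mul_le_mul_left _ ((Finset.card_le_card h1).trans Finset.card_biUnion_le)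
      _ = ∑ p ∈ Finset.univ.filter (fun p : W × W => p.1 ≠ p.2),
          N * (Finset.univ.filter fun x => ex x p.1 = ex x p.2).card := Finset.mul_sum _ _ _
      _ ≤ ∑ p ∈ Finset.univ.filter (fun p : W × W => p.1 ≠ p.2),
          (1 + J) * N ^ Fintype.card {r // isRoot E r} := by
          refine Finset.sum_le_sum fun p hp => hZ _ _ ?_
          simpa using hp
      _ ≤ _ := by
          rw [Finset.sum_const, smul_eq_mul]
          refine Nat.mul_le_mul_right _ ((Finset.card_le_univ _).trans ?_)
          rw [Fintype.card_prod, sq]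
  rw [hn]
  refine ⟨by omega, ?_⟩
  rw [← htot] at hbad ⊢
  rw [mul_add]
  omega

/-- the pairs counted by `pGraph` -/
noncomputable def TT (A : Set ℕ) (E : W → W → Prop) (N : ℕ) : ℕ :=
  (Finset.univ.filter fun q : (W → Fin N) × Equiv.Perm (Fin N) =>
    Injective q.1 ∧ q.2 ∈ PS A (Fin N) ∧ ∀ a b, E a b → q.2 (q.1 a) = q.1 b).card

theorem TT_sum (A : Set ℕ) {π : Equiv.Perm {w // inL E w}} (hπ : ∀ l, E l.1 (π l).1) (N : ℕ) :
    TT A E N = ∑ fL ∈ Finset.univ.filter (fun fL : {w // inL E w} → Fin N => Injective fL),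
      ∑ σ ∈ (PS A (Fin N)).filter (fun σ => ∀ l, σ (fL l) = fL (π l)), nx E fL σ := by
  unfold TT
  rw [Finset.sum_sigma', Finset.card_eq_sum_card_fiberwise
    (f := fun q => (⟨fun l => q.1 l.1, q.2⟩ : Σ _ : {w // inL E w} → Fin N, Equiv.Perm (Fin N)))
    (t := (Finset.univ.filter (fun fL : {w // inL E w} → Fin N => Injective fL)).sigma
      fun fL => (PS A (Fin N)).filter (fun σ => ∀ l, σ (fL l) = fL (π l)))]
  · refine Finset.sum_congr rfl fun b hb => ?_
    obtain ⟨fL, σ⟩ := b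
    simp only [Finset.mem_sigma, Finset.mem_filter, Finset.mem_univ, true_and] at hb
    unfold nx
    refine Finset.card_bij (fun q _ => q.1) ?_ ?_ ?_
    · rintro ⟨f, σ'⟩ h
      simp only [Finset.mem_filter, Finset.mem_univ, true_and, Sigma.mk.injEq, heq_eq_eq] at h ⊢
      obtain ⟨⟨h1, h2, h3⟩, h4, rfl⟩ := h
      exact ⟨h1, fun l => congrFun h4 l, h3⟩
    · rintro ⟨f, σ'⟩ h ⟨f', σ''⟩ h' he
      simp only [Finset.mem_filter, Finset.mem_univ, true_and, Sigma.mk.injEq, heq_eq_eq] at h h' he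
      rw [he, h.2.2, h'.2.2]
    · intro f h
      simp only [Finset.mem_filter, Finset.mem_univ, true_and, Sigma.mk.injEq, heq_eq_eq] at h
      refine ⟨(f, σ), ?_, rfl⟩
      simp only [Finset.mem_filter, Finset.mem_univ, true_and, Sigma.mk.injEq, heq_eq_eq]
      exact ⟨⟨h.1, hb.2.1, h.2.2⟩, funext h.2.1, trivial⟩
  · rintro ⟨f, σ⟩ h
    simp only [Finset.coe_filter, Finset.mem_univ, true_and, Set.mem_ofPred_eq] at h
    simp only [Finset.coe_sigma, Set.mem_sigma_iff, Finset.coe_filter, Finset.mem_univ, true_and, Set.mem_ofPred_eq]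
    exact ⟨fun a b hab => Subtype.ext (h.1 hab), h.2.1, fun l => h.2.2 _ _ (hπ l)⟩

theorem TT_bounds (A : Set ℕ) (hf : ∀ a b b', E a b → E a b' → b = b')
    (hi : ∀ a a' b, E a b → E a' b → a = a') {π : Equiv.Perm {w // inL E w}}
    (hπ : ∀ l, E l.1 (π l).1) (hA : ∀ l, minimalPeriod π l ∈ A)
    {K : ℕ} (hK : ∀ r n v, isRoot E r → St E n r v → n ≤ K)
    {N M : ℕ} (hN : N = Fintype.card {w // inL E w} + M) :
    TT A E N ≤ N.descFactorial (Fintype.card {w // inL E w}) *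
      ((PS A (Fin M)).card * N ^ Fintype.card {r // isRoot E r}) ∧
    N * (N.descFactorial (Fintype.card {w // inL E w}) *
      ((PS A (Fin M)).card * N ^ Fintype.card {r // isRoot E r})) ≤ N * TT A E N +
      N.descFactorial (Fintype.card {w // inL E w}) * ∑ τ ∈ PS A (Fin M), Fintype.card W ^ 2 *
        ((1 + ∑ k ∈ Finset.Icc 1 K, (Jc k π + Jc k τ)) * N ^ Fintype.card {r // isRoot E r}) := by
  rw [TT_sum A hπ]
  have hcv : ∀ g : Equiv.Perm (Fin N) → ℕ, ∀ fL : {w // inL E w} → Fin N, Injective fL →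
      True := fun _ _ _ => trivial
  have hcard := card_inj {w // inL E w} N
  rw [← hcard]
  rw [← smul_eq_mul (Finset.card _), ← smul_eq_mul (Finset.card _) (∑ τ ∈ _, _),
    ← Finset.sum_const, ← Finset.sum_const, Finset.mul_sum, Finset.mul_sum,
    ← Finset.sum_add_distrib]
  constructor
  · refine Finset.sum_le_sum fun fL hfL => ?_
    simp only [Finset.mem_filter, Finset.mem_univ, true_and] at hfL
    obtain ⟨Φ, h1, h2, h3⟩ := core A π hA hN fL hfL
    have hcc : (PS A (Fin M)).card = ((PS A (Fin N)).filter (fun σ => ∀ l, σ (fL l) = fL (π l))).card := by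
      rw [← h2, Finset.card_image_of_injective _ h1]
    rw [hcc, ← smul_eq_mul, ← Finset.sum_const]
    refine Finset.sum_le_sum fun σ hσ => ?_
    simp only [Finset.mem_filter] at hσ
    exact (nx_bounds hf hi hπ hK fL hfL σ hσ.2).1
  · refine Finset.sum_le_sum fun fL hfL => ?_
    simp only [Finset.mem_filter, Finset.mem_univ, true_and] at hfL
    obtain ⟨Φ, h1, h2, h3⟩ := core A π hA hN fL hfL
    rw [← h2, Finset.sum_image (fun a _ b _ h => h1 h), ← smul_eq_mul (Finset.card _), ← Finset.sum_const,
      Finset.mul_sum, Finset.mul_sum, ← Finset.sum_add_distrib]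
    refine Finset.sum_le_sum fun τ hτ => ?_
    have hm : Φ τ ∈ (PS A (Fin N)).filter (fun σ => ∀ l, σ (fL l) = fL (π l)) := by
      rw [← h2]; exact Finset.mem_image_of_mem _ hτ
    simp only [Finset.mem_filter] at hm
    have := (nx_bounds hf hi hπ hK fL hfL (Φ τ) hm.2).2
    simpa only [h3] using this
end count
end PG

open Filter Topology
namespace PG
open Function

theorem desc_tendsto (v : ℕ) : Tendsto (fun N : ℕ => (N : ℝ) ^ v / (N.descFactorial v : ℝ)) atTop (𝓝 1) := by
  induction v with
  | zero => simp
  | succ v ih =>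
    have h := ih.mul ((sub_div_tendsto v).inv₀ one_ne_zero)
    rw [inv_one, mul_one] at h
    refine h.congr fun N => ?_
    rw [Nat.descFactorial_succ, Nat.cast_mul, pow_succ, inv_div]
    rw [div_mul_div_comm, mul_comm ((N.descFactorial v : ℕ) : ℝ)]

open Classical in
theorem main_limit {A : Set ℕ} (hne : A.Nonempty) (hpos : ∀ a ∈ A, 0 < a)
    (hcond : A.Finite ∨ Summable ((Aᶜ : Set ℕ).indicator fun j => (1 : ℝ) / j))
    {d : ℕ∞}
    (hd : (∀ a ∈ A, (a : ℕ∞) ≤ d) ∧ ∀ e : ℕ∞, (∀ a ∈ A, (a : ℕ∞) ≤ e) → d ≤ e)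
    {W : Type} [Fintype W] {E : W → W → Prop} (hf : ∀ a b b', E a b → E a b' → b = b')
    (hi : ∀ a a' b, E a b → E a' b → a = a') {π : Equiv.Perm {w // inL E w}}
    (hπ : ∀ l, E l.1 (π l).1) (hA : ∀ l, minimalPeriod π l ∈ A)
    {K : ℕ} (hK : ∀ r n v, isRoot E r → St E n r v → n ≤ K) (hKd : (K : ℕ∞) < d)
    {k : ℕ} (hk : k = Fintype.card {w // inL E w}) (hkA : k ∈ AddSubmonoid.closure A) {e : ℕ}
    (he : e + Fintype.card {r // isRoot E r} = Fintype.card W) :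
    Tendsto (fun N : ℕ => (TT A E N : ℝ) / ((N.descFactorial (Fintype.card W) : ℝ) *
      ((PS A (Fin N)).card : ℝ)) / (N : ℝ) ^ (-(e : ℝ) + (k : ℝ) * (d.toNat : ℝ)⁻¹)) (FF A) (𝓝 1) := by
  have R2 := ratio_closure hne hpos hcond hd hkA
  have hM := pos_of_ratio R2
  have R3 := (desc_tendsto (Fintype.card W)).mono_left (FF_le A)
  set s := Fintype.card {r // isRoot E r} with hs
  set w := Fintype.card W with hw
  have hsh := shift_tendsto hM
  have hEx : ∀ j ∈ Finset.Icc 1 K, Tendsto (fun N : ℕ => Ex A j (N - k) (fun x => (x : ℝ)) / N) (FF A) (𝓝 0) := by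
    intro j hj
    have hjd : (j : ℕ∞) < d := lt_of_le_of_lt (by exact_mod_cast (Finset.mem_Icc.1 hj).2) hKd
    have h1 := ((small_mem hne hpos hcond hd hjd).comp hsh).mul ((sub_div_tendsto k).mono_left (FF_le A))
    rw [zero_mul] at h1
    refine h1.congr' ?_
    filter_upwards [FF_ge A (k + 1)] with N hN
    have : ((N - k : ℕ) : ℝ) ≠ 0 := by
      have : 0 < N - k := by omega
      positivity
    simp only [comp]
    field_simp
  set C : ℝ := 1 + ∑ j ∈ Finset.Icc 1 K, (Jc j π : ℝ) with hC
  have hB : Tendsto (fun N : ℕ => 1 - (w : ℝ) ^ 2 * (C / N + ∑ j ∈ Finset.Icc 1 K,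
      Ex A j (N - k) (fun x => (x : ℝ)) / N)) (FF A) (𝓝 1) := by
    have h1 := (tendsto_const_div_atTop_nhds_zero_nat C).mono_left (FF_le A)
    have h2 := tendsto_finsetSum _ hEx
    have h3 := ((h1.add h2).const_mul ((w : ℝ) ^ 2)).const_sub 1
    simpa using h3
  have R1 : Tendsto (fun N : ℕ => (TT A E N : ℝ) / ((N.descFactorial k : ℝ) *
      (((PS A (Fin (N - k))).card : ℝ) * (N : ℝ) ^ s))) (FF A) (𝓝 1) := by
    refine tendsto_of_tendsto_of_tendsto_of_le_of_le' hB tendsto_const_nhds ?_ ?_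
    · filter_upwards [hM, FF_ge A (k + 1)] with N hMp hNk
      have hNr : (0 : ℝ) < N := by
        have : 0 < N := by omega
        exact_mod_cast this
      have ha : (0 : ℝ) < ((PS A (Fin (N - k))).card : ℝ) := lt_of_le_of_ne (by positivity) (card_ne hMp).symm
      have hD : (0 : ℝ) < (N.descFactorial k : ℝ) := by
        exact_mod_cast Nat.pos_of_ne_zero (by rw [Ne, Nat.descFactorial_eq_zero_iff_lt]; omega)
      have hb := (TT_bounds A hf hi hπ hA hK (N := N) (M := N - k) (by omega)).2
      rw [← hk, ← hs, ← hw] at hb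
      have hb' : (N : ℝ) * ((N.descFactorial k : ℝ) * (((PS A (Fin (N - k))).card : ℝ) * (N : ℝ) ^ s)) ≤
        N * TT A E N + (N.descFactorial k : ℝ) * ∑ τ ∈ PS A (Fin (N - k)), (w : ℝ) ^ 2 *
          ((1 + ∑ j ∈ Finset.Icc 1 K, ((Jc j π : ℝ) + Jc j τ)) * (N : ℝ) ^ s) := by exact_mod_cast hb
      have hsum : ∑ τ ∈ PS A (Fin (N - k)), (w : ℝ) ^ 2 *
          ((1 + ∑ j ∈ Finset.Icc 1 K, ((Jc j π : ℝ) + Jc j τ)) * (N : ℝ) ^ s)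
          = (w : ℝ) ^ 2 * (N : ℝ) ^ s * ((PS A (Fin (N - k))).card : ℝ) *
            (C + ∑ j ∈ Finset.Icc 1 K, Ex A j (N - k) (fun x => (x : ℝ))) := by
        have e1 : ∀ j, ∑ τ ∈ PS A (Fin (N - k)), (Jc j τ : ℝ) =
            ((PS A (Fin (N - k))).card : ℝ) * Ex A j (N - k) (fun x => (x : ℝ)) := by
          intro j
          unfold Ex
          rw [← Finset.mul_sum, ← mul_assoc, mul_inv_cancel₀ ha.ne', one_mul]
        rw [← Finset.mul_sum, ← Finset.sum_mul, Finset.sum_add_distrib, Finset.sum_comm]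
        simp only [Finset.sum_add_distrib, e1, Finset.sum_const, nsmul_eq_mul]
        rw [← Finset.mul_sum, ← Finset.mul_sum, hC]
        ring
      rw [hsum] at hb'
      rw [← Finset.sum_div, ← add_div, le_div_iff₀ (by positivity)]
      set S := ∑ j ∈ Finset.Icc 1 K, Ex A j (N - k) (fun x => (x : ℝ))
      set a := ((PS A (Fin (N - k))).card : ℝ)
      set D := (N.descFactorial k : ℝ)
      refine le_of_mul_le_mul_left ?_ hNr
      have : (N : ℝ) * ((1 - (w : ℝ) ^ 2 * ((C + S) / N)) * (D * (a * (N : ℝ) ^ s)))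
        = N * (D * (a * (N : ℝ) ^ s)) - D * ((w : ℝ) ^ 2 * (N : ℝ) ^ s * a * (C + S)) := by
        field_simp
      rw [this]; linarith
    · filter_upwards [FF_ge A (k + 1)] with N hNk
      apply div_le_one_of_le₀ _ (by positivity)
      have hb := (TT_bounds A hf hi hπ hA hK (N := N) (M := N - k) (by omega)).1
      rw [← hk, ← hs] at hb
      exact_mod_cast hb
  have R := (R1.mul R2).mul R3
  rw [one_mul, one_mul] at R
  refine R.congr' ?_
  filter_upwards [hM, FF_pos A, FF_ge A (k + 1), FF_ge A (w + 1)] with N hMp hNp hNk hNw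
  have hNr : (0 : ℝ) < N := by
    have : 0 < N := by omega
    exact_mod_cast this
  have ha := card_ne hMp
  have ha' := card_ne hNp
  have hD : (N.descFactorial k : ℝ) ≠ 0 := by
    exact_mod_cast (by rw [Ne, Nat.descFactorial_eq_zero_iff_lt]; omega : N.descFactorial k ≠ 0)
  have hD' : (N.descFactorial w : ℝ) ≠ 0 := by
    exact_mod_cast (by rw [Ne, Nat.descFactorial_eq_zero_iff_lt]; omega : N.descFactorial w ≠ 0)
  have hfac : (N.factorial : ℝ) = (N - k).factorial * N.descFactorial k := by
    exact_mod_cast (Nat.factorial_mul_descFactorial (show k ≤ N by omega)).symm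
  have hf1 : ((N - k).factorial : ℝ) ≠ 0 := by positivity
  rw [Real.rpow_add hNr, Real.rpow_neg hNr.le, Real.rpow_natCast]
  have hq : (N : ℝ) ^ ((k : ℝ) * (d.toNat : ℝ)⁻¹) ≠ 0 := (Real.rpow_pos_of_pos hNr _).ne'
  set q := (N : ℝ) ^ ((k : ℝ) * (d.toNat : ℝ)⁻¹)
  unfold cc
  rw [hfac, ← he, pow_add]
  field_simp
end PG

open Filter Topology
namespace PG
open Function

section graph
variable {V : Type} {Γ : CGraph V 1}

theorem adj_mem {a b : V} (h : Γ.Adj a b) : b ∈ Γ.verts := by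
  obtain ⟨r, h | h⟩ := h
  · exact Γ.memR _ _ _ h
  · exact Γ.memL _ _ _ h

theorem rtg_mem {a b : V} (ha : a ∈ Γ.verts) (h : Relation.ReflTransGen Γ.Adj a b) : b ∈ Γ.verts := by
  induction h with
  | refl => exact ha
  | tail _ h _ => exact adj_mem h

theorem adj_symm {a b : V} (h : Γ.Adj a b) : Γ.Adj b a := by
  obtain ⟨r, h⟩ := h
  exact ⟨r, h.symm⟩

theorem rtg_symm {a b : V} (h : Relation.ReflTransGen Γ.Adj a b) : Relation.ReflTransGen Γ.Adj b a :=
  h.head_induction_on Relation.ReflTransGen.refl fun h' _ ih => ih.tail (adj_symm h')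

variable (Γ) in
/-- the connected component of a vertex -/
def comp (v : ↥Γ.verts) : CGraph V 1 where
  verts := {w | Relation.ReflTransGen Γ.Adj v.1 w}
  finite := Γ.finite.subset fun _ hw => rtg_mem v.2 hw
  nonem := ⟨v.1, Relation.ReflTransGen.refl⟩
  E := fun r a b => Γ.E r a b ∧ Relation.ReflTransGen Γ.Adj v.1 a
  memL := fun _ _ _ h => h.2
  memR := fun r _ _ h => h.2.tail ⟨r, Or.inl h.1⟩

theorem sub_le {C : CGraph V 1} (h1 : C.Subgraph (Γ.mono 0)) (h2 : C.Connected) (v : ↥Γ.verts)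
    (hv : v.1 ∈ C.verts) : C.Subgraph (comp Γ v) := by
  have h3 : ∀ w ∈ C.verts, Relation.ReflTransGen Γ.Adj v.1 w := by
    intro w hw
    refine Relation.ReflTransGen.mono ?_ _ _ (h2 _ hv _ hw)
    rintro a b ⟨r, h | h⟩
    · exact ⟨r, Or.inl (h1.2 _ _ _ h).2⟩
    · exact ⟨r, Or.inr (h1.2 _ _ _ h).2⟩
  exact ⟨h3, fun r a b h => ⟨(h1.2 _ _ _ h).2, h3 _ (C.memL _ _ _ h)⟩⟩

theorem comp_sub (v : ↥Γ.verts) : (comp Γ v).Subgraph (Γ.mono 0) :=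
  ⟨fun _ hw => rtg_mem (Γ := Γ) v.2 hw, fun r _ _ h => ⟨Subsingleton.elim _ _, h.1⟩⟩

theorem comp_conn (v : ↥Γ.verts) : (comp Γ v).Connected := by
  have h1 : ∀ w, Relation.ReflTransGen Γ.Adj v.1 w → Relation.ReflTransGen (comp Γ v).Adj v.1 w := by
    intro w hw
    induction hw with
    | refl => exact Relation.ReflTransGen.refl
    | tail h h' ih =>
      refine ih.tail ?_
      obtain ⟨r, h'' | h''⟩ := h'
      · exact ⟨r, Or.inl ⟨h'', h⟩⟩
      · exact ⟨r, Or.inr ⟨h'', h.tail ⟨r, Or.inr h''⟩⟩⟩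
  intro a ha b hb
  exact (rtg_symm (h1 a ha)).trans (h1 b hb)

theorem comp_comp (v : ↥Γ.verts) : (comp Γ v).IsComponent (Γ.mono 0) :=
  ⟨comp_sub v, comp_conn v, fun _ h1 h2 h3 => sub_le h1 h2 v (h3.1 Relation.ReflTransGen.refl)⟩

theorem sub_antisymm {P Q : CGraph V 1} (h1 : P.Subgraph Q) (h2 : Q.Subgraph P) : P = Q := by
  have e1 : P.verts = Q.verts := Set.Subset.antisymm h1.1 h2.1
  have e2 : P.E = Q.E := by
    funext r a b
    exact propext ⟨h1.2 _ _ _, h2.2 _ _ _⟩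
  cases P; cases Q
  cases e1; cases e2; rfl

theorem comp_eq {P : CGraph V 1} (hP : P.IsComponent (Γ.mono 0)) (v : ↥Γ.verts) (hv : v.1 ∈ P.verts) :
    P = comp Γ v := by
  have h := sub_le hP.1 hP.2.1 v hv
  exact sub_antisymm h (hP.2.2 _ (comp_sub v) (comp_conn v) h)

theorem path_comp {P : CGraph V 1} (hP : P.IsPathOf Γ) : P.IsComponent (Γ.mono 0) := by
  obtain ⟨r, h, _⟩ := hP
  rwa [Subsingleton.elim r 0] at h

variable (Γ) in
/-- edge relation on the vertex subtype -/
def EE (a b : ↥Γ.verts) : Prop := Γ.E 0 a.1 b.1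

theorem EE_f (hΓ : Γ.Admissible) : ∀ a b b', EE Γ a b → EE Γ a b' → b = b' :=
  fun _ _ _ h h' => Subtype.ext (hΓ.1 _ _ _ _ h h')

theorem EE_i (hΓ : Γ.Admissible) : ∀ a a' b, EE Γ a b → EE Γ a' b → a = a' :=
  fun _ _ _ h h' => Subtype.ext (hΓ.2 _ _ _ _ h h')

theorem E_zero {r : Fin 1} {a b : V} {P : CGraph V 1} : P.E r a b ↔ P.E 0 a b := by
  rw [Subsingleton.elim r 0]

/-- vertices of loops are in `L` -/
theorem loop_inL (hΓ : Γ.Admissible) {P : CGraph V 1} (hP : P.IsLoopOf Γ) (v : ↥Γ.verts)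
    (hv : v.1 ∈ P.verts) : inL (EE Γ) v := by
  have hc := path_comp hP.1
  have hcl : ∀ a : ↥P.verts, ∃ b : ↥P.verts, P.E 0 a.1 b.1 := by
    intro a
    obtain ⟨r, b, h⟩ := hP.2 a.1 a.2
    exact ⟨⟨b, P.memR _ _ _ h⟩, E_zero.1 h⟩
  choose g hg using hcl
  have : Finite ↥P.verts := P.finite.to_subtype
  have hG : ∀ a, Γ.E 0 a.1 (g a).1 := fun a => (hc.1.2 _ _ _ (hg a)).2
  have hinj : Injective g := by
    intro a b h
    apply Subtype.ext
    apply hΓ.2 0 _ _ _ (hG a)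
    rw [h]; exact hG b
  have hit : ∀ n, ∀ a : ↥P.verts, St (EE Γ) n ⟨a.1, hc.1.1 a.2⟩ ⟨(g^[n] a).1, hc.1.1 (g^[n] a).2⟩ := by
    intro n a
    induction n with
    | zero => exact rfl
    | succ n ih =>
      simp only [iterate_succ_apply']
      exact ⟨_, ih, hG _⟩
  obtain ⟨n, hn, hp⟩ := hinj.mem_periodicPts ⟨v.1, hv⟩
  refine ⟨n, hn, ?_⟩
  have := hit n ⟨v.1, hv⟩
  rw [hp.eq] at this
  exact this

theorem St_rtg {n : ℕ} {a b : ↥Γ.verts} (h : St (EE Γ) n a b) : Relation.ReflTransGen Γ.Adj a.1 b.1 := by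
  induction n generalizing b with
  | zero => cases h; exact Relation.ReflTransGen.refl
  | succ n ih =>
    obtain ⟨c, h1, h2⟩ := h
    exact (ih h1).tail ⟨0, Or.inl h2⟩

theorem orbit_of_rtg (hΓ : Γ.Admissible) {π : Equiv.Perm {w // inL (EE Γ) w}} (hπ : ∀ l, EE Γ l.1 (π l).1)
    (l : {w // inL (EE Γ) w}) {w : V} (h : Relation.ReflTransGen Γ.Adj l.1.1 w) :
    ∃ n, (π^[n] l).1.1 = w := by
  have : Finite ↥Γ.verts := Γ.finite.to_subtype
  induction h with
  | refl => exact ⟨0, rfl⟩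
  | tail _ h ih =>
    obtain ⟨n, rfl⟩ := ih
    obtain ⟨r, h | h⟩ := h
    · refine ⟨n + 1, ?_⟩
      rw [iterate_succ_apply']
      exact hΓ.1 0 _ _ _ (hπ _) (E_zero.1 h)
    · have hm := minPer_pos π l
      refine ⟨n + (minimalPeriod π l - 1), ?_⟩
      have h1 : Γ.E 0 (π^[n + (minimalPeriod π l - 1)] l).1.1 (π^[n] l).1.1 := by
        have h2 := hπ (π^[n + (minimalPeriod π l - 1)] l)
        rw [← iterate_succ_apply' π, show (n + (minimalPeriod π l - 1)).succ = n + minimalPeriod π l by omega,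
          iterate_add_minimalPeriod_eq] at h2
        exact h2
      exact hΓ.2 0 _ _ _ h1 (E_zero.1 h)

theorem comp_loop (hΓ : Γ.Admissible) (l : {w // inL (EE Γ) w}) : (comp Γ l.1).IsLoopOf Γ := by
  have : Finite ↥Γ.verts := Γ.finite.to_subtype
  obtain ⟨π, hπ⟩ := exists_perm (EE_f hΓ) (EE_i hΓ)
  refine ⟨⟨0, comp_comp _, fun h => h 0 l.1.1 (π l).1.1 ⟨hπ l, Relation.ReflTransGen.refl⟩⟩, ?_⟩
  intro a ha
  obtain ⟨n, rfl⟩ := orbit_of_rtg hΓ hπ l ha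
  exact ⟨0, (π (π^[n] l)).1.1, hπ _, ha⟩

instance edge_finite (P : CGraph V 1) : Finite {p : Fin 1 × V × V // P.E p.1 p.2.1 p.2.2} := by
  have : Finite ↥P.verts := P.finite.to_subtype
  refine Finite.of_injective (β := ↥P.verts × ↥P.verts)
    (fun p => (⟨p.1.2.1, P.memL _ _ _ p.2⟩, ⟨p.1.2.2, P.memR _ _ _ p.2⟩)) ?_
  rintro ⟨⟨r, a, b⟩, h⟩ ⟨⟨r', a', b'⟩, h'⟩ he
  simp only [Prod.mk.injEq, Subtype.mk.injEq] at he
  obtain ⟨rfl, rfl⟩ := he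
  cases Subsingleton.elim r r'
  rfl

theorem edge_closed (hΓ : Γ.Admissible) {P : CGraph V 1} (hP : P.IsLoopOf Γ) :
    P.edgeCount = Nat.card ↥P.verts := by
  have hc := path_comp hP.1
  unfold CGraph.edgeCount
  refine Nat.card_eq_of_bijective (fun p => ⟨p.1.2.1, P.memL _ _ _ p.2⟩) ⟨?_, ?_⟩
  · rintro ⟨⟨r, a, b⟩, h⟩ ⟨⟨r', a', b'⟩, h'⟩ he
    simp only [Subtype.mk.injEq] at he
    subst he
    cases Subsingleton.elim r r'
    cases hΓ.1 _ _ _ _ (hc.1.2 _ _ _ h).2 (hc.1.2 _ _ _ h').2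
    rfl
  · rintro ⟨a, ha⟩
    obtain ⟨r, b, h⟩ := hP.2 a ha
    exact ⟨⟨(r, a, b), h⟩, rfl⟩

theorem comp_edge (hΓ : Γ.Admissible) {π : Equiv.Perm {w // inL (EE Γ) w}} (hπ : ∀ l, EE Γ l.1 (π l).1)
    (l : {w // inL (EE Γ) w}) : (comp Γ l.1).edgeCount = minimalPeriod π l := by
  have : Finite ↥Γ.verts := Γ.finite.to_subtype
  rw [edge_closed hΓ (comp_loop hΓ l)]
  symm
  rw [← Nat.card_fin (minimalPeriod π l)]
  have hm := minPer_pos π l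
  refine Nat.card_eq_of_bijective (fun i => ⟨(π^[i.1] l).1.1, ?_⟩) ⟨?_, ?_⟩
  · exact St_rtg ((St_perm (EE_f hΓ) hπ l i.1 _).2 rfl)
  · intro i j h
    have h := congrArg Subtype.val h
    exact Fin.ext (iterate_injOn_Iio_minimalPeriod i.2 j.2 (Subtype.ext (Subtype.ext h)))
  · rintro ⟨w, hw⟩
    obtain ⟨n, rfl⟩ := orbit_of_rtg hΓ hπ l hw
    exact ⟨⟨n % minimalPeriod π l, Nat.mod_lt _ hm⟩, by simp [iterate_mod_minimalPeriod_eq]⟩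

/-- loops and their vertices -/
theorem loops_surj (hΓ : Γ.Admissible) : Surjective (fun l : {w // inL (EE Γ) w} =>
    (⟨comp Γ l.1, comp_loop hΓ l⟩ : {P : CGraph V 1 // P.IsLoopOf Γ})) := by
  rintro ⟨P, hP⟩
  have hc := path_comp hP.1
  obtain ⟨v, hv⟩ := P.nonem
  refine ⟨⟨⟨v, hc.1.1 hv⟩, loop_inL hΓ hP ⟨v, hc.1.1 hv⟩ hv⟩, Subtype.ext ?_⟩
  exact (comp_eq hc ⟨v, hc.1.1 hv⟩ hv).symm

theorem loops_finite (hΓ : Γ.Admissible) : Finite {P : CGraph V 1 // P.IsLoopOf Γ} :=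
  have : Finite ↥Γ.verts := Γ.finite.to_subtype
  Finite.of_surjective _ (loops_surj hΓ)

theorem loops_sum (hΓ : Γ.Admissible) [Fintype {P : CGraph V 1 // P.IsLoopOf Γ}] :
    Nat.card {w // inL (EE Γ) w} = ∑ P : {P : CGraph V 1 // P.IsLoopOf Γ}, P.1.edgeCount := by
  have : Finite ↥Γ.verts := Γ.finite.to_subtype
  rw [← Nat.card_congr (Equiv.sigmaFiberEquiv (fun l : {w // inL (EE Γ) w} =>
    (⟨comp Γ l.1, comp_loop hΓ l⟩ : {P : CGraph V 1 // P.IsLoopOf Γ}))), Nat.card_sigma]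
  refine Finset.sum_congr rfl fun P _ => ?_
  obtain ⟨P, hP⟩ := P
  have hc := path_comp hP.1
  rw [edge_closed hΓ hP]
  have hmem : ∀ l : {w // inL (EE Γ) w}, comp Γ l.1 = P → l.1.1 ∈ P.verts := by
    rintro l rfl; exact Relation.ReflTransGen.refl
  refine Nat.card_eq_of_bijective (fun l => ⟨l.1.1.1, hmem l.1 (congrArg Subtype.val l.2)⟩) ⟨?_, ?_⟩
  · intro a b h
    simp only [Subtype.mk.injEq] at h
    exact Subtype.ext (Subtype.ext (Subtype.ext h))
  · rintro ⟨v, hv⟩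
    refine ⟨⟨⟨⟨v, hc.1.1 hv⟩, loop_inL hΓ hP ⟨v, hc.1.1 hv⟩ hv⟩, Subtype.ext ?_⟩, rfl⟩
    exact (comp_eq hc ⟨v, hc.1.1 hv⟩ hv).symm

theorem string_bound (hΓ : Γ.Admissible) {d : ℕ∞} (hd : 0 < d)
    (hS : ∀ P : CGraph V 1, P.IsStringOf Γ → (P.edgeCount : ℕ∞) < d)
    {r v : ↥Γ.verts} {n : ℕ} (hr : isRoot (EE Γ) r) (h : St (EE Γ) n r v) : (n : ℕ∞) < d := by
  rcases Nat.eq_zero_or_pos n with rfl | hn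
  · exact_mod_cast hd
  have hst : ∀ i : Fin n, ∃ a b, St (EE Γ) i.1 r a ∧ EE Γ a b := by
    intro i
    rw [show n = i.1 + (1 + (n - i.1 - 1)) by omega] at h
    obtain ⟨a, h1, h2⟩ := St_split h
    obtain ⟨b, h3, _⟩ := St_split h2
    exact ⟨a, b, h1, St_one.1 h3⟩
  choose a b ha hab using hst
  have hp : (comp Γ r).IsStringOf Γ := by
    have hpath : (comp Γ r).IsPathOf Γ :=
      ⟨0, comp_comp _, fun h => h 0 _ _ ⟨hab ⟨0, hn⟩, St_rtg (ha _)⟩⟩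
    refine ⟨hpath, fun hcl => ?_⟩
    exact not_inL_of_root (EE_i hΓ) hr (n := 0) rfl
      (loop_inL hΓ ⟨hpath, hcl⟩ r Relation.ReflTransGen.refl)
  refine lt_of_le_of_lt ?_ (hS _ hp)
  norm_cast
  unfold CGraph.edgeCount
  rw [← Nat.card_fin n]
  refine Nat.card_le_card_of_injective (fun i => ⟨(0, (a i).1, (b i).1), hab i, St_rtg (ha i)⟩) ?_
  intro i j hij
  have hij : (a i).1 = (a j).1 := congrArg (fun p => p.1.2.1) hij
  have h2 := ha j
  rw [← Subtype.ext hij] at h2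
  exact Fin.ext (root_unique (EE_i hΓ) hr hr (ha i) h2).1

theorem exists_K (hΓ : Γ.Admissible) {d : ℕ∞} (hd : 0 < d)
    (hS : ∀ P : CGraph V 1, P.IsStringOf Γ → (P.edgeCount : ℕ∞) < d) :
    ∃ K : ℕ, (∀ r n v, isRoot (EE Γ) r → St (EE Γ) n r v → n ≤ K) ∧ (K : ℕ∞) < d := by
  classical
  have : Finite ↥Γ.verts := Γ.finite.to_subtype
  have hfin : {n | ∃ r v, isRoot (EE Γ) r ∧ St (EE Γ) n r v}.Finite := by
    refine (Set.finite_range (fun v => if h : ∃ n, ∃ r, isRoot (EE Γ) r ∧ St (EE Γ) n r v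
      then h.choose else 0)).subset ?_
    rintro n ⟨r, v, hr, h⟩
    have hex : ∃ n, ∃ r, isRoot (EE Γ) r ∧ St (EE Γ) n r v := ⟨n, r, hr, h⟩
    refine ⟨v, ?_⟩
    simp only [dif_pos hex]
    obtain ⟨r', hr', h'⟩ := hex.choose_spec
    exact (root_unique (EE_i hΓ) hr' hr h' h).1
  refine ⟨hfin.toFinset.sup id, ?_, ?_⟩
  · intro r n v hr h
    exact Finset.le_sup (f := id) (hfin.mem_toFinset.2 ⟨r, v, hr, h⟩)
  · refine Finset.sup_induction (p := fun n : ℕ => (n : ℕ∞) < d) (by simpa using hd) ?_ ?_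
    · intro x hx y hy
      rcases le_total x y with h | h
      · rwa [sup_eq_right.2 h]
      · rwa [sup_eq_left.2 h]
    · intro n hn
      obtain ⟨r, v, hr, h⟩ := hfin.mem_toFinset.1 hn
      exact string_bound hΓ hd hS hr h

theorem edges_roots (hΓ : Γ.Admissible) [Fintype ↥Γ.verts] [Fintype {r // isRoot (EE Γ) r}] :
    Γ.edgeCount + Fintype.card {r // isRoot (EE Γ) r} = Fintype.card ↥Γ.verts := by
  classical
  have h : Γ.edgeCount = Fintype.card {r // ¬ isRoot (EE Γ) r} := by
    rw [← Nat.card_eq_fintype_card]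
    unfold CGraph.edgeCount
    refine Nat.card_eq_of_bijective (fun p => ⟨⟨p.1.2.2, Γ.memR _ _ _ p.2⟩, fun h =>
      h ⟨p.1.2.1, Γ.memL _ _ _ p.2⟩ (E_zero.1 p.2)⟩) ⟨?_, ?_⟩
    · rintro ⟨⟨r, a, b⟩, h⟩ ⟨⟨r', a', b'⟩, h'⟩ he
      simp only [Subtype.mk.injEq] at he
      subst he
      cases Subsingleton.elim r r'
      cases hΓ.2 _ _ _ _ h h'
      rfl
    · rintro ⟨b, hb⟩
      unfold isRoot at hb
      push Not at hb
      obtain ⟨a, ha⟩ := hb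
      exact ⟨⟨(0, a.1, b.1), ha⟩, rfl⟩
  rw [h, add_comm, ← Fintype.card_sum]
  exact Fintype.card_congr (Equiv.sumCompl _)

end graph
end PG

/-- Let `A` be a non-empty set of positive integers which is finite or satisfies
`Σ_{j∉A} 1/j < ∞`, let `d = sup A`, and let `Γ` be an `A`-graph. Then
`p_N^(A)(Γ) ∼ N^{−E(Γ) + L(Γ) + Σ_{loops P} (l(P)/d − 1)}` as `N → ∞` along those
`N` with `S_N^(A) ≠ ∅` (with `l(P)/∞ := 0`, realized by `(d.toNat)⁻¹ = 0` when
`d = ∞`). -/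
theorem pGraph_asymptotics (A : Set ℕ) (hne : A.Nonempty) (hpos : ∀ a ∈ A, 0 < a)
    (hcond : A.Finite ∨ Summable ((Aᶜ : Set ℕ).indicator fun j => (1 : ℝ) / j))
    (d : ℕ∞)
    (hd : (∀ a ∈ A, (a : ℕ∞) ≤ d) ∧ ∀ e : ℕ∞, (∀ a ∈ A, (a : ℕ∞) ≤ e) → d ≤ e)
    {V : Type} (Γ : CGraph V 1) (hΓ : IsAGraph A d Γ) :
    Tendsto
      (fun N : ℕ => pGraph A N Γ / (N : ℝ) ^
        (-(Γ.edgeCount : ℝ) + (Γ.loopCount : ℝ) +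
          ∑ᶠ P : {P : CGraph V 1 // P.IsLoopOf Γ},
            ((P.1.edgeCount : ℝ) * ((d.toNat : ℝ))⁻¹ - 1)))
      (atTop ⊓ 𝓟 {N : ℕ | (permSet A N).Nonempty}) (𝓝 1) := by
  classical
  letI : Fintype ↥Γ.verts := Γ.finite.fintype
  obtain ⟨hadm, hloop, hstr⟩ := hΓ
  have hf := PG.EE_f hadm
  have hi := PG.EE_i hadm
  obtain ⟨π, hπ⟩ := PG.exists_perm hf hi
  have hA : ∀ l, Function.minimalPeriod π l ∈ A := by
    intro l
    rw [← PG.comp_edge hadm hπ l]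
    exact hloop _ (PG.comp_loop hadm l)
  have hd0 : 0 < d := by
    obtain ⟨a, ha⟩ := hne
    have h1 : (0 : ℕ∞) < (a : ℕ∞) := by exact_mod_cast hpos a ha
    exact lt_of_lt_of_le h1 (hd.1 a ha)
  obtain ⟨K, hK, hKd⟩ := PG.exists_K hadm hd0 hstr
  haveI := PG.loops_finite hadm
  letI : Fintype {P : CGraph V 1 // P.IsLoopOf Γ} := Fintype.ofFinite _
  have hsum := PG.loops_sum hadm
  rw [Nat.card_eq_fintype_card] at hsum
  have hcl : (∑ P : {P : CGraph V 1 // P.IsLoopOf Γ}, P.1.edgeCount) ∈ AddSubmonoid.closure A :=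
    sum_mem fun P _ => AddSubmonoid.subset_closure (hloop P.1 P.2)
  have main := PG.main_limit hne hpos hcond hd hf hi hπ hA hK hKd hsum.symm hcl
    (PG.edges_roots hadm)
  have hexp : -(Γ.edgeCount : ℝ) + (Γ.loopCount : ℝ) +
      ∑ᶠ P : {P : CGraph V 1 // P.IsLoopOf Γ}, ((P.1.edgeCount : ℝ) * ((d.toNat : ℝ))⁻¹ - 1)
      = -(Γ.edgeCount : ℝ) +
        ((∑ P : {P : CGraph V 1 // P.IsLoopOf Γ}, P.1.edgeCount : ℕ) : ℝ) * (d.toNat : ℝ)⁻¹ := by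
    rw [finsum_eq_sum_of_fintype, Finset.sum_sub_distrib, ← Finset.sum_mul]
    unfold CGraph.loopCount
    rw [Nat.card_eq_fintype_card]
    push_cast
    simp
  have hfil : atTop ⊓ 𝓟 {N : ℕ | (permSet A N).Nonempty} = PG.FF A := by
    unfold PG.FF
    congr 2
    ext N
    exact (PG.cc_pos_iff A N).symm
  rw [hexp, hfil]
  refine main.congr fun N => ?_
  congr 1
  unfold pGraph
  rw [PG.card_permSet, ← PG.card_inj ↥Γ.verts N, Nat.card_eq_fintype_card, Nat.card_eq_fintype_card,
    Fintype.card_subtype, Fintype.card_subtype]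
  unfold PG.TT
  congr 2
  apply congrArg
  ext ⟨f, σ⟩
  simp only [Finset.mem_filter, Finset.mem_univ, true_and]
  refine and_congr Iff.rfl (and_congr ?_ ?_)
  · simp [PG.PS, permSet]
  · constructor
    · intro h r a b hab
      rw [Subsingleton.elim r 0] at hab
      exact h a b hab
    · intro h a b hab
      exact h 0 a b hab
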